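/- arXiv:2108.07643 — 6 statements merged into one kernel-verified Lean document; each statement's English description precedes it below -/
import Mathlib

section
/- Let Ψ:[-1,1]→ℝ have a real analytic extension to an open neighbourhood of [-1,1], let Ω = {(x,y)∈(-1,1)×ℝ : y<Ψ(x)}, U₁ = (-1,1)×ℝ, h ∈ C¹([-1,1]), and let G(x,y) := (1/π)∫_{-1}^{1} h(t)√(1+Ψ'(t)²) · log√((x−t)² + (y−Ψ(t))²) dt on U₁∖cl(Ω). Then for every x₀ ∈ (-1,1), the tangential combination (∂G/∂x)(x,y) + Ψ'(x)(∂G/∂y)(x,y) has a finite limit as (x,y) → (x₀,Ψ(x₀)) with (x,y) ∈ U₁∖cl(Ω); consequently both first-order partial derivatives of G extend continuously to the graph Γ = {(x,Ψ(x)) : x∈(-1,1)}. -/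
open MeasureTheory Filter Topology Set

/-- Partial derivative in the first coordinate. -/
noncomputable def pdx (F : ℝ × ℝ → ℝ) (p : ℝ × ℝ) : ℝ :=
  deriv (fun x => F (x, p.2)) p.1

/-- Partial derivative in the second coordinate. -/
noncomputable def pdy (F : ℝ × ℝ → ℝ) (p : ℝ × ℝ) : ℝ :=
  deriv (fun y => F (p.1, y)) p.2

/-- Differentiation under the integral sign of a logarithmic potential off the branch cuts. -/
lemma hasDerivAt_integral_mul_log {a b : ℝ} (hab : a ≤ b) {w η : ℝ → ℂ}
    (hw : ContinuousOn w (Icc a b)) (hη : ContinuousOn η (Icc a b)) {u₀ : ℂ}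
    (hu : ∀ t ∈ Icc a b, u₀ - η t ∈ Complex.slitPlane) :
    HasDerivAt (fun u => ∫ t in a..b, w t * Complex.log (u - η t))
      (∫ t in a..b, w t / (u₀ - η t)) u₀ := by
  obtain ⟨δ, hδ, hsub⟩ := (isCompact_Icc.image_of_continuousOn
    (continuousOn_const.sub hη)).exists_thickening_subset_open
    Complex.isOpen_slitPlane (by rintro _ ⟨t, ht, rfl⟩; exact hu t ht)
  have hball : ∀ t ∈ Icc a b, ∀ u ∈ Metric.ball u₀ (δ / 2), u - η t ∈ Complex.slitPlane := by
    intro t ht u hu'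
    refine hsub (Metric.mem_thickening_iff.2 ⟨u₀ - η t, ⟨t, ht, rfl⟩, ?_⟩)
    rw [dist_sub_right]
    exact (Metric.mem_ball.1 hu').trans (by linarith)
  have hlow : ∀ t ∈ Icc a b, ∀ u ∈ Metric.ball u₀ (δ / 2), δ / 2 ≤ ‖u - η t‖ := by
    intro t ht u hu'
    have h0 : δ ≤ ‖u₀ - η t‖ := by
      by_contra! hlt
      refine Complex.zero_notMem_slitPlane
        (hsub (Metric.mem_thickening_iff.2 ⟨u₀ - η t, ⟨t, ht, rfl⟩, ?_⟩))
      rwa [dist_zero_left]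
    have h1 : ‖u₀ - η t‖ ≤ ‖u₀ - u‖ + ‖u - η t‖ := by
      simpa using norm_add_le (u₀ - u) (u - η t)
    have h2 : ‖u₀ - u‖ < δ / 2 := by
      rw [← dist_eq_norm, dist_comm]; exact hu'
    linarith
  obtain ⟨M, hM⟩ := isCompact_Icc.exists_bound_of_continuousOn hw
  have hI : uIoc a b ⊆ Icc a b := by rw [uIoc_of_le hab]; exact Ioc_subset_Icc_self
  have hcont : ∀ u ∈ Metric.ball u₀ (δ / 2),
      ContinuousOn (fun t => w t * Complex.log (u - η t)) (Icc a b) := fun u hu' =>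
    hw.mul ((continuousOn_const.sub hη).clog fun t ht => hball t ht u hu')
  have hu₀ : u₀ ∈ Metric.ball u₀ (δ / 2) := Metric.mem_ball_self (by positivity)
  refine (intervalIntegral.hasDerivAt_integral_of_dominated_loc_of_deriv_le
    (F := fun u t => w t * Complex.log (u - η t)) (F' := fun u t => w t / (u - η t))
    (bound := fun _ => M / (δ / 2))
    (Metric.ball_mem_nhds u₀ (half_pos hδ)) ?_ ?_ ?_ ?_ ?_ ?_).2
  · filter_upwards [Metric.ball_mem_nhds u₀ (half_pos hδ)] with u hu'
    exact ((hcont u hu').mono hI).aestronglyMeasurable measurableSet_uIoc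
  · exact (uIcc_of_le hab ▸ hcont u₀ hu₀ :
      ContinuousOn _ (uIcc a b)).intervalIntegrable
  · refine ContinuousOn.aestronglyMeasurable (ContinuousOn.mono ?_ hI) measurableSet_uIoc
    exact hw.div (continuousOn_const.sub hη) fun t ht =>
      Complex.slitPlane_ne_zero (hball t ht u₀ hu₀)
  · refine .of_forall fun t ht u hu' => ?_
    rw [norm_div]
    exact div_le_div₀ ((norm_nonneg _).trans (hM t (hI ht))) (hM t (hI ht)) (by positivity)
      (hlow t (hI ht) u hu')
  · exact intervalIntegrable_const
  · refine .of_forall fun t ht u hu' => ?_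
    have := (((hasDerivAt_id u).sub_const (η t)).clog (hball t (hI ht) u hu')).const_mul (w t)
    simpa [div_eq_mul_inv] using this

/-- Integration by parts turns a Cauchy integral into a logarithmic one. -/
lemma integral_div_eq_log {a b : ℝ} (hab : a ≤ b) {g g' η η' : ℝ → ℂ}
    (hg : ContinuousOn g (Icc a b)) (hg' : ContinuousOn g' (Icc a b))
    (hgd : ∀ t ∈ Ioo a b, HasDerivAt g (g' t) t)
    (hη : ContinuousOn η (Icc a b)) (hη' : ContinuousOn η' (Icc a b))
    (hηd : ∀ t ∈ Ioo a b, HasDerivAt η (η' t) t) {u : ℂ}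
    (hu : ∀ t ∈ Icc a b, u - η t ∈ Complex.slitPlane) :
    ∫ t in a..b, g t * (-η' t / (u - η t)) =
      g b * Complex.log (u - η b) - g a * Complex.log (u - η a)
        - ∫ t in a..b, g' t * Complex.log (u - η t) := by
  have hsub : ContinuousOn (fun t => u - η t) (Icc a b) := continuousOn_const.sub hη
  rw [← uIcc_of_le hab] at hg hg' hη'
  refine intervalIntegral.integral_mul_deriv_eq_deriv_mul_of_hasDerivAt
    (v := fun t => Complex.log (u - η t)) hg ?_ ?_ ?_
    hg'.intervalIntegrable ?_
  · rw [uIcc_of_le hab]; exact hsub.clog hu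
  · rw [min_eq_left hab, max_eq_right hab]; exact hgd
  · rw [min_eq_left hab, max_eq_right hab]
    exact fun t ht => ((hηd t ht).const_sub u).clog_real (hu t (Ioo_subset_Icc_self ht))
  · refine ContinuousOn.intervalIntegrable (hη'.neg.div ?_ ?_)
    · rwa [uIcc_of_le hab]
    · rw [uIcc_of_le hab]; exact fun t ht => Complex.slitPlane_ne_zero (hu t ht)

lemma norm_log_le_of_abs_im {z : ℂ} {s M : ℝ} (hs : s ≠ 0) (him : z.im = s) (hM : ‖z‖ ≤ M)
    (h1 : 1 ≤ M) : ‖Complex.log z‖ ≤ |Real.log s| + (Real.log M + Real.pi) := by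
  have hle : |s| ≤ ‖z‖ := him ▸ Complex.abs_im_le_norm z
  have hpos : 0 < |s| := abs_pos.2 hs
  have hre : |Real.log ‖z‖| ≤ |Real.log s| + Real.log M := by
    have h2 := Real.log_le_log hpos hle
    have h3 := Real.log_le_log (hpos.trans_le hle) hM
    have h4 := Real.log_nonneg h1
    rw [Real.log_abs] at h2
    rw [abs_le]
    constructor <;> linarith [neg_abs_le (Real.log s), abs_nonneg (Real.log s)]
  calc ‖Complex.log z‖ ≤ |(Complex.log z).re| + |(Complex.log z).im| :=
        Complex.norm_le_abs_re_add_abs_im _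
    _ ≤ _ := by
        rw [Complex.log_re, Complex.log_im]
        linarith [Complex.abs_arg_le_pi z]

/-- A logarithmic integral over a graph depends continuously on the pole, up to and across
the graph. -/
lemma continuousOn_integral_mul_log {a b : ℝ} (hab : a ≤ b) {k : ℝ → ℂ} {Ψ : ℝ → ℝ}
    (hk : ContinuousOn k (Icc a b)) (hΨ : ContinuousOn Ψ (Icc a b)) :
    ContinuousOn (fun p : ℝ × ℝ => ∫ t in a..b, k t * Complex.log ⟨p.2 - Ψ t, t - p.1⟩)
      (Ioo a b ×ˢ univ) := by
  set A : ℝ → Set ℝ := fun x => {s | s + x ∈ Ioo a b ∧ s ≠ 0}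
  have hAo : ∀ x, IsOpen (A x) := fun x =>
    (isOpen_Ioo.preimage (continuous_add_const x)).inter isOpen_ne
  set f : ℝ × ℝ → ℝ → ℂ := fun p s => k (s + p.1) * Complex.log ⟨p.2 - Ψ (s + p.1), s⟩ with hf
  have hrepr : ∀ p : ℝ × ℝ, ∫ t in a..b, k t * Complex.log ⟨p.2 - Ψ t, t - p.1⟩ =
      ∫ s, (A p.1).indicator (f p) s := by
    intro p
    rw [intervalIntegral.integral_of_le hab, integral_Ioc_eq_integral_Ioo,
      ← integral_indicator measurableSet_Ioo, ← integral_add_right_eq_self _ p.1]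
    refine integral_congr_ae ?_
    filter_upwards [compl_mem_ae_iff.2 (measure_singleton (0 : ℝ))] with s hs
    have hs0 : s ≠ 0 := hs
    by_cases hm : s + p.1 ∈ Ioo a b
    · rw [indicator_of_mem hm, indicator_of_mem (show s ∈ A p.1 from ⟨hm, hs0⟩)]
      simp [hf]
    · rw [indicator_of_notMem hm, indicator_of_notMem fun h => hm h.1]
  simp_rw [hrepr]
  rintro ⟨x₀, y₀⟩ ⟨hx₀, -⟩
  refine ContinuousAt.continuousWithinAt ?_
  obtain ⟨M, hM⟩ := isCompact_Icc.exists_bound_of_continuousOn hk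
  obtain ⟨N, hN⟩ := isCompact_Icc.exists_bound_of_continuousOn hΨ
  have hM0 : 0 ≤ M := (norm_nonneg _).trans (hM x₀ (Ioo_subset_Icc_self hx₀))
  have hN0 : 0 ≤ N := (norm_nonneg _).trans (hN x₀ (Ioo_subset_Icc_self hx₀))
  set R : ℝ := |y₀| + 1 + N + (b - a) + 1 with hR
  have hnear : ∀ᶠ p : ℝ × ℝ in 𝓝 (x₀, y₀), p.1 ∈ Ioo a b ∧ |p.2| < |y₀| + 1 := by
    refine (continuous_fst.continuousAt.eventually (isOpen_Ioo.mem_nhds hx₀)).and ?_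
    exact (continuous_snd.abs.continuousAt (x := (x₀, y₀))).eventually_lt
      continuousAt_const (by simp)
  refine continuousAt_of_dominated
    (bound := (Ioc (-(b - a)) (b - a)).indicator fun s =>
      M * (|Real.log s| + (Real.log R + Real.pi))) ?_ ?_ ?_ ?_
  · refine .of_forall fun p => ?_
    rw [aestronglyMeasurable_indicator_iff (hAo _).measurableSet]
    refine ContinuousOn.aestronglyMeasurable ?_ (hAo _).measurableSet
    have hmaps : MapsTo (fun s => s + p.1) (A p.1) (Icc a b) :=
      fun s hs => Ioo_subset_Icc_self hs.1
    refine (hk.comp (continuous_add_const _).continuousOn hmaps).mul ?_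
    have hΨ' : ContinuousOn (fun s => Ψ (s + p.1)) (A p.1) :=
      hΨ.comp (continuous_add_const _).continuousOn hmaps
    refine ContinuousOn.clog ?_ fun s hs => Complex.mem_slitPlane_iff.2 (Or.inr hs.2)
    simp only [Complex.mk_eq_add_mul_I]
    fun_prop
  · filter_upwards [hnear] with p hp
    refine .of_forall fun s => ?_
    by_cases hs : s ∈ A p.1
    · have hs' := hs.1
      have hIoc : s ∈ Ioc (-(b - a)) (b - a) := by
        constructor <;> linarith [hp.1.1, hp.1.2, hs'.1, hs'.2]
      have hsI := Ioo_subset_Icc_self hs'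
      rw [indicator_of_mem hs, indicator_of_mem hIoc, norm_mul]
      refine mul_le_mul (hM _ hsI) ?_ (norm_nonneg _) hM0
      refine norm_log_le_of_abs_im hs.2 rfl ?_ (by rw [hR]; linarith [abs_nonneg y₀, hx₀.1, hx₀.2])
      refine (Complex.norm_le_abs_re_add_abs_im _).trans ?_
      have h1 := hN _ hsI
      rw [Real.norm_eq_abs] at h1
      have h2 := abs_sub p.2 (Ψ (s + p.1))
      have h3 : |s| ≤ b - a := abs_le.2 ⟨hIoc.1.le, hIoc.2⟩
      show |p.2 - Ψ (s + p.1)| + |s| ≤ R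
      rw [hR]
      linarith [hp.2]
    · rw [indicator_of_notMem hs, norm_zero]
      refine indicator_nonneg (fun s _ => ?_) s
      have : 0 ≤ Real.log R := Real.log_nonneg (by rw [hR]; linarith [abs_nonneg y₀, hx₀.1, hx₀.2])
      positivity
  · rw [integrable_indicator_iff measurableSet_Ioc, ← intervalIntegrable_iff_integrableOn_Ioc_of_le
      (by linarith)]
    exact ((intervalIntegral.intervalIntegrable_log'.abs).add
      intervalIntegrable_const).const_mul M
  · have hne : ∀ c : ℝ, ∀ᵐ s : ℝ, s ≠ c := fun c =>
      compl_mem_ae_iff.2 (measure_singleton c)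
    filter_upwards [hne 0, hne (a - x₀), hne (b - x₀)] with s hs0 hsa hsb
    have hct : ContinuousAt (fun p : ℝ × ℝ => s + p.1) (x₀, y₀) := by fun_prop
    by_cases hs : s + x₀ ∈ Ioo a b
    · have hev : ∀ᶠ p : ℝ × ℝ in 𝓝 (x₀, y₀), s + p.1 ∈ Ioo a b :=
        hct.eventually (isOpen_Ioo.mem_nhds hs)
      have hkc : ContinuousAt (fun p : ℝ × ℝ => k (s + p.1)) (x₀, y₀) :=
        ContinuousAt.comp (f := fun p : ℝ × ℝ => s + p.1)
          (hk.continuousAt (Icc_mem_nhds hs.1 hs.2)) hct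
      have hΨc : ContinuousAt (fun p : ℝ × ℝ => Ψ (s + p.1)) (x₀, y₀) :=
        ContinuousAt.comp (f := fun p : ℝ × ℝ => s + p.1)
          (hΨ.continuousAt (Icc_mem_nhds hs.1 hs.2)) hct
      have hfc : ContinuousAt (fun p : ℝ × ℝ => f p s) (x₀, y₀) := by
        refine hkc.mul (ContinuousAt.clog ?_ (Complex.mem_slitPlane_iff.2 (Or.inr hs0)))
        simp only [Complex.mk_eq_add_mul_I]
        exact (Complex.continuous_ofReal.continuousAt.comp
          (continuousAt_snd.sub hΨc)).add continuousAt_const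
      refine hfc.congr ?_
      filter_upwards [hev] with p hp
      rw [indicator_of_mem (show s ∈ A p.1 from ⟨hp, hs0⟩)]
    · have hmem : s + x₀ ∈ (Icc a b)ᶜ := by
        intro h
        exact hs ⟨lt_of_le_of_ne h.1 fun e => hsa (by linarith),
          lt_of_le_of_ne h.2 fun e => hsb (by linarith)⟩
      have hev : ∀ᶠ p : ℝ × ℝ in 𝓝 (x₀, y₀), s + p.1 ∈ (Icc a b)ᶜ :=
        hct.eventually (isClosed_Icc.isOpen_compl.mem_nhds hmem)
      refine (continuousAt_const (y := (0 : ℂ))).congr ?_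
      filter_upwards [hev] with p hp
      rw [indicator_of_notMem fun h => hp (Ioo_subset_Icc_self h.1)]

lemma sub_mem_slitPlane {Ψ : ℝ → ℝ} {p : ℝ × ℝ} (hp : Ψ p.1 < p.2) (t : ℝ) :
    (⟨p.2 - Ψ t, t - p.1⟩ : ℂ) ∈ Complex.slitPlane := by
  rw [Complex.mem_slitPlane_iff]
  rcases eq_or_ne t p.1 with rfl | hne
  · exact Or.inl (sub_pos.2 hp)
  · exact Or.inr (sub_ne_zero.2 hne)

/-- The complex logarithmic potential above the graph has real part the single-layer potential. -/
lemma re_integral_mul_log {a b : ℝ} (hab : a ≤ b) {w Ψ : ℝ → ℝ}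
    (hw : ContinuousOn w (Icc a b)) (hΨ : ContinuousOn Ψ (Icc a b)) {p : ℝ × ℝ}
    (hp : Ψ p.1 < p.2) :
    ∫ t in a..b, w t * Real.log (Real.sqrt ((p.1 - t) ^ 2 + (p.2 - Ψ t) ^ 2)) =
      (∫ t in a..b, (w t : ℂ) * Complex.log ((p.2 - p.1 * Complex.I) -
        (Ψ t - t * Complex.I))).re := by
  have heq : ∀ t, ((p.2 - p.1 * Complex.I) - (Ψ t - t * Complex.I) : ℂ) =
      ⟨p.2 - Ψ t, t - p.1⟩ := fun t => by apply Complex.ext <;> simp; ring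
  simp only [heq]
  have hcont : ContinuousOn (fun t => (w t : ℂ) * Complex.log ⟨p.2 - Ψ t, t - p.1⟩)
      (uIcc a b) := by
    rw [uIcc_of_le hab]
    refine (Complex.continuous_ofReal.comp_continuousOn hw).mul
      (ContinuousOn.clog ?_ fun t _ => sub_mem_slitPlane hp t)
    simp only [Complex.mk_eq_add_mul_I]
    fun_prop
  have := intervalIntegral.intervalIntegral_re (hcont.intervalIntegrable (μ := volume))
  rw [RCLike.re_eq_complex_re] at this
  rw [← this]
  refine intervalIntegral.integral_congr fun t _ => ?_
  simp only [Complex.re_ofReal_mul, Complex.log_re, Complex.norm_def, Complex.normSq_apply]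
  congr 3
  ring

/-- The partial derivatives above the graph of a single-layer potential extend continuously to the
whole strip. -/
lemma exists_continuousOn_hasDerivAt_singleLayer {a b : ℝ} (hab : a < b) {w Ψ : ℝ → ℝ}
    (hw : ContDiffOn ℝ 1 w (Icc a b)) (hΨ : ∀ t ∈ Icc a b, DifferentiableAt ℝ Ψ t)
    (hΨ' : ContDiffOn ℝ 1 (deriv Ψ) (Icc a b)) {G : ℝ × ℝ → ℝ}
    (hG : ∀ p : ℝ × ℝ, G p = ∫ t in a..b,
      w t * Real.log (Real.sqrt ((p.1 - t) ^ 2 + (p.2 - Ψ t) ^ 2))) :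
    ∃ E : ℝ × ℝ → ℂ, ContinuousOn E (Ioo a b ×ˢ univ) ∧
      ∀ p : ℝ × ℝ, p.1 ∈ Ioo a b → Ψ p.1 < p.2 →
        HasDerivAt (fun x => G (x, p.2)) (E p).im p.1 ∧
        HasDerivAt (fun y => G (p.1, y)) (E p).re p.2 := by
  have hΨc : ContinuousOn Ψ (Icc a b) := fun t ht => (hΨ t ht).continuousAt.continuousWithinAt
  set η : ℝ → ℂ := fun t => Ψ t - t * Complex.I with hη
  set η' : ℝ → ℂ := fun t => deriv Ψ t - Complex.I with hη'
  set g : ℝ → ℂ := fun t => -(w t / η' t) with hg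
  have hη'0 : ∀ t, η' t ≠ 0 := fun t h0 => by simpa [hη'] using congrArg Complex.im h0
  have hηd : ∀ t ∈ Icc a b, HasDerivAt η (η' t) t := fun t ht => by
    have := (hΨ t ht).hasDerivAt.ofReal_comp.sub
      ((hasDerivAt_id t).ofReal_comp.mul_const Complex.I)
    rwa [Complex.ofReal_one, one_mul] at this
  have hηc : ContinuousOn η (Icc a b) := fun t ht => (hηd t ht).continuousAt.continuousWithinAt
  have hη'1 : ContDiffOn ℝ 1 η' (Icc a b) :=
    (Complex.ofRealCLM.contDiff.comp_contDiffOn hΨ').sub contDiffOn_const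
  have hw1 : ContDiffOn ℝ 1 (fun t => (w t : ℂ)) (Icc a b) :=
    Complex.ofRealCLM.contDiff.comp_contDiffOn hw
  have hg1 : ContDiffOn ℝ 1 g (Icc a b) := by
    simp only [hg, div_eq_mul_inv]
    exact (hw1.mul (hη'1.inv fun t _ => hη'0 t)).neg
  have hg'c : ContinuousOn (derivWithin g (Icc a b)) (Icc a b) :=
    hg1.continuousOn_derivWithin (uniqueDiffOn_Icc hab) le_rfl
  have hgd : ∀ t ∈ Ioo a b, HasDerivAt g (derivWithin g (Icc a b) t) t := fun t ht =>
    ((hg1.differentiableOn one_ne_zero t (Ioo_subset_Icc_self ht)).hasDerivWithinAt).hasDerivAt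
      (Icc_mem_nhds ht.1 ht.2)
  have heq : ∀ (p : ℝ × ℝ) t, ((p.2 - p.1 * Complex.I) - η t : ℂ) = ⟨p.2 - Ψ t, t - p.1⟩ :=
    fun p t => by apply Complex.ext <;> simp [hη]; ring
  have hlog : ∀ c : ℝ, c ∉ Ioo a b → ContinuousOn
      (fun p : ℝ × ℝ => Complex.log ⟨p.2 - Ψ c, c - p.1⟩) (Ioo a b ×ˢ univ) := fun c hc => by
    refine ContinuousOn.clog ?_ fun p hp => Complex.mem_slitPlane_iff.2 (Or.inr ?_)
    · simp only [Complex.mk_eq_add_mul_I]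
      fun_prop
    · exact sub_ne_zero.2 fun h => hc (h ▸ hp.1)
  refine ⟨fun p => g b * Complex.log ⟨p.2 - Ψ b, b - p.1⟩
    - g a * Complex.log ⟨p.2 - Ψ a, a - p.1⟩
    - ∫ t in a..b, derivWithin g (Icc a b) t * Complex.log ⟨p.2 - Ψ t, t - p.1⟩,
    ((continuousOn_const.mul (hlog b (by simp))).sub
      (continuousOn_const.mul (hlog a (by simp)))).sub
      (continuousOn_integral_mul_log hab.le hg'c hΨc), fun p hpI hp => ?_⟩
  set u : ℝ × ℝ → ℂ := fun q => q.2 - q.1 * Complex.I with hu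
  have hslit : ∀ t ∈ Icc a b, u p - η t ∈ Complex.slitPlane := fun t _ => by
    rw [hu, heq]; exact sub_mem_slitPlane hp t
  have hK := hasDerivAt_integral_mul_log hab.le hw1.continuousOn hηc hslit
  have hibp := integral_div_eq_log hab.le hg1.continuousOn hg'c hgd hηc hη'1.continuousOn
    (fun t ht => hηd t (Ioo_subset_Icc_self ht)) hslit
  have hint : ∫ t in a..b, (w t : ℂ) / (u p - η t) = ∫ t in a..b, g t * (-η' t / (u p - η t)) := by
    refine intervalIntegral.integral_congr fun t _ => ?_
    simp only [hg]
    field_simp [hη'0 t]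
  rw [hint, hibp] at hK
  simp only [hu, heq] at hK
  set D : ℂ := g b * Complex.log ⟨p.2 - Ψ b, b - p.1⟩
    - g a * Complex.log ⟨p.2 - Ψ a, a - p.1⟩
    - ∫ t in a..b, derivWithin g (Icc a b) t * Complex.log ⟨p.2 - Ψ t, t - p.1⟩
  have hΨp : ContinuousAt Ψ p.1 := (hΨ _ (Ioo_subset_Icc_self hpI)).continuousAt
  have hGK : ∀ q : ℝ × ℝ, Ψ q.1 < q.2 → G q = (∫ t in a..b, (w t : ℂ) *
      Complex.log ((q.2 - q.1 * Complex.I) - η t)).re := fun q hq =>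
    (hG q).trans (re_integral_mul_log hab.le hw.continuousOn hΨc hq)
  constructor
  · have hux : HasDerivAt (fun x : ℝ => (p.2 - x * Complex.I : ℂ)) (-Complex.I) p.1 := by
      simpa using ((hasDerivAt_id p.1).ofReal_comp.mul_const Complex.I).const_sub (p.2 : ℂ)
    have := Complex.reCLM.hasFDerivAt.comp_hasDerivAt p.1 (hK.comp p.1 hux)
    refine HasDerivAt.congr_of_eventuallyEq ?_ ((hΨp.eventually_lt continuousAt_const hp).mono
      fun x hx => hGK (x, p.2) hx)
    have him : Complex.reCLM (D * -Complex.I) = D.im := by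
      simp only [Complex.reCLM_apply, Complex.mul_re, Complex.neg_re, Complex.neg_im, Complex.I_re,
        Complex.I_im]
      ring
    rw [him] at this
    exact this
  · have huy : HasDerivAt (fun y : ℝ => (y - p.1 * Complex.I : ℂ)) 1 p.2 := by
      simpa using ((hasDerivAt_id p.2).ofReal_comp).sub_const (p.1 * Complex.I : ℂ)
    have := Complex.reCLM.hasFDerivAt.comp_hasDerivAt p.2 (hK.comp p.2 huy)
    refine HasDerivAt.congr_of_eventuallyEq ?_ ((eventually_gt_nhds hp).mono
      fun y hy => hGK (p.1, y) hy)
    rw [mul_one, Complex.reCLM_apply] at this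
    exact this

/-- (the tangential combination of first derivatives of the single-layer
potential has a limit at the graph; consequently both first-order partial derivatives of `G`
extend continuously to the graph `Γ`, i.e. to `U₁ ∖ Ω`). -/
theorem stmt10 (Ψ h : ℝ → ℝ)
    (hΨ : ∃ V : Set ℝ, IsOpen V ∧ Set.Icc (-1 : ℝ) 1 ⊆ V ∧ AnalyticOnNhd ℝ Ψ V)
    (hh : ContDiffOn ℝ 1 h (Set.Icc (-1 : ℝ) 1))
    (Ω : Set (ℝ × ℝ)) (hΩ : Ω = {p : ℝ × ℝ | p.1 ∈ Set.Ioo (-1 : ℝ) 1 ∧ p.2 < Ψ p.1})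
    (U₁ : Set (ℝ × ℝ)) (hU₁ : U₁ = Set.Ioo (-1 : ℝ) 1 ×ˢ (Set.univ : Set ℝ))
    (G : ℝ × ℝ → ℝ)
    (hG : ∀ p : ℝ × ℝ, G p = (1 / Real.pi) * ∫ t in (-1 : ℝ)..1,
      h t * Real.sqrt (1 + deriv Ψ t ^ 2) *
        Real.log (Real.sqrt ((p.1 - t) ^ 2 + (p.2 - Ψ t) ^ 2))) :
    -- the tangential combination ∂G/∂x + Ψ'(x) ∂G/∂y has a finite limit at each boundary point
    (∀ x₀ ∈ Set.Ioo (-1 : ℝ) 1, ∃ L : ℝ,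
      Filter.Tendsto (fun p : ℝ × ℝ => pdx G p + deriv Ψ p.1 * pdy G p)
        (𝓝[U₁ \ closure Ω] (x₀, Ψ x₀)) (𝓝 L)) ∧
    -- consequently both first-order partials of G extend continuously to U₁ ∖ Ω
    (∃ Gx Gy : ℝ × ℝ → ℝ,
      ContinuousOn Gx (U₁ \ Ω) ∧ ContinuousOn Gy (U₁ \ Ω) ∧
      (∀ p ∈ U₁ \ closure Ω, Gx p = pdx G p) ∧
      (∀ p ∈ U₁ \ closure Ω, Gy p = pdy G p)) := by
  obtain ⟨V, -, hV, hΨV⟩ := hΨ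
  have hΨ' : ContDiffOn ℝ 1 (deriv Ψ) (Icc (-1) 1) :=
    ((hΨV.deriv).mono hV).contDiffOn (uniqueDiffOn_Icc (by norm_num))
  have hw : ContDiffOn ℝ 1 (fun t => h t * Real.sqrt (1 + deriv Ψ t ^ 2)) (Icc (-1) 1) :=
    hh.mul ((contDiffOn_const.add (hΨ'.pow 2)).sqrt fun t _ => by positivity)
  set S : ℝ × ℝ → ℝ := fun p => ∫ t in (-1 : ℝ)..1,
    h t * Real.sqrt (1 + deriv Ψ t ^ 2) *
      Real.log (Real.sqrt ((p.1 - t) ^ 2 + (p.2 - Ψ t) ^ 2))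
  obtain ⟨E, hE, hEd⟩ := exists_continuousOn_hasDerivAt_singleLayer (by norm_num) hw
    (fun t ht => (hΨV t (hV ht)).differentiableAt) hΨ'
    (G := S) fun p => rfl
  have habove : ∀ p ∈ U₁ \ closure Ω, p.1 ∈ Ioo (-1 : ℝ) 1 ∧ Ψ p.1 < p.2 := by
    intro p hp
    have hp1 : p.1 ∈ Ioo (-1 : ℝ) 1 := (hU₁ ▸ hp.1 : p ∈ Ioo (-1 : ℝ) 1 ×ˢ univ).1
    refine ⟨hp1, ?_⟩
    by_contra! hle
    refine hp.2 (closure_mono (s := {p.1} ×ˢ Iio (Ψ p.1)) ?_ ?_)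
    · rintro ⟨x, y⟩ ⟨rfl, hy⟩
      rw [hΩ]
      exact ⟨hp1, hy⟩
    · rw [closure_prod_eq, closure_singleton, closure_Iio]
      exact ⟨rfl, hle⟩
  have hGe : G = fun p => (1 / Real.pi) * S p := funext hG
  have hx : ∀ p ∈ U₁ \ closure Ω, 1 / Real.pi * (E p).im = pdx G p := fun p hp => by
    rw [pdx, hGe]
    exact ((hEd p (habove p hp).1 (habove p hp).2).1.const_mul (1 / Real.pi)).deriv.symm
  have hy : ∀ p ∈ U₁ \ closure Ω, 1 / Real.pi * (E p).re = pdy G p := fun p hp => by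
    rw [pdy, hGe]
    exact ((hEd p (habove p hp).1 (habove p hp).2).2.const_mul (1 / Real.pi)).deriv.symm
  have hEx : ContinuousOn (fun p => 1 / Real.pi * (E p).im) U₁ := by
    rw [hU₁]; exact continuousOn_const.mul (Complex.continuous_im.comp_continuousOn hE)
  have hEy : ContinuousOn (fun p => 1 / Real.pi * (E p).re) U₁ := by
    rw [hU₁]; exact continuousOn_const.mul (Complex.continuous_re.comp_continuousOn hE)
  refine ⟨fun x₀ hx₀ => ?_, _, _, hEx.mono sdiff_subset, hEy.mono sdiff_subset, hx, hy⟩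
  have hmem : (x₀, Ψ x₀) ∈ U₁ := by rw [hU₁]; exact ⟨hx₀, mem_univ _⟩
  have hΨc : ContinuousOn (fun p : ℝ × ℝ => deriv Ψ p.1) U₁ := by
    rw [hU₁]
    exact hΨ'.continuousOn.comp continuousOn_fst fun p hp => Ioo_subset_Icc_self hp.1
  have htendsto : Tendsto (fun p => 1 / Real.pi * (E p).im + deriv Ψ p.1 * (1 / Real.pi * (E p).re))
      (𝓝[U₁ \ closure Ω] (x₀, Ψ x₀)) (𝓝 _) :=
    ((hEx.add (hΨc.mul hEy)).continuousWithinAt hmem).mono sdiff_subset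
  refine ⟨_, htendsto.congr' ?_⟩
  filter_upwards [self_mem_nhdsWithin] with p hp
  rw [hx p hp, hy p hp]
end

section
/- Let Ψ:[-1,1]→ℝ have a real analytic extension to an open neighbourhood of [-1,1], let h ∈ C¹([-1,1]) with h not identically zero, and for x ∈ (-1,1), y > Ψ(x) set Ĩ₁(x,y,t) := (y−Ψ(x)) / [ (x−t)² + (y−Ψ(x) + Ψ'(x)(x−t))² ]. Then for every x₀ ∈ (-1,1), (1/π)∫_{-1}^{1} h(t)√(1+Ψ'(t)²) · Ĩ₁(x,y,t) dt → h(x₀)√(1+Ψ'(x₀)²) as (x,y) → (x₀,Ψ(x₀)) with y > Ψ(x). -/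
open MeasureTheory Filter Topology Set

/-- Rescaling `t = x - η (v - a) / (1 + a²)` turns the kernel `η / ((x - t)² + (η + a (x - t))²)`
into the Cauchy kernel `1 / (1 + v²)`. -/
lemma integral_mul_kernel_eq (G : ℝ → ℝ) (x a η : ℝ) (hη : 0 < η) :
    ∫ t, G t * (η / ((x - t) ^ 2 + (η + a * (x - t)) ^ 2)) =
      ∫ v, G (x - η * (v - a) / (1 + a ^ 2)) * (1 + v ^ 2)⁻¹ := by
  have hb : 0 < 1 + a ^ 2 := by positivity
  have hc : 0 < η / (1 + a ^ 2) := by positivity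
  set g : ℝ → ℝ := fun t => G t * (η / ((x - t) ^ 2 + (η + a * (x - t)) ^ 2)) with hg
  have h1 : ∫ w, g (x + η * a / (1 + a ^ 2) - w) = ∫ t, g t :=
    integral_sub_left_eq_self g volume _
  have h2 := Measure.integral_comp_mul_left
    (fun w => g (x + η * a / (1 + a ^ 2) - w)) (η / (1 + a ^ 2))
  rw [h1, abs_of_pos (inv_pos.2 hc), smul_eq_mul] at h2
  have h3 : ∫ t, g t = (η / (1 + a ^ 2)) *
      ∫ v, g (x + η * a / (1 + a ^ 2) - η / (1 + a ^ 2) * v) := by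
    rw [h2, mul_inv_cancel_left₀ hc.ne']
  rw [h3, ← integral_const_mul]
  refine integral_congr_ae (Eventually.of_forall fun v => ?_)
  have hv : 0 < 1 + v ^ 2 := by positivity
  have e1 : x + η * a / (1 + a ^ 2) - η / (1 + a ^ 2) * v = x - η * (v - a) / (1 + a ^ 2) := by
    ring
  have e2 : (x - (x - η * (v - a) / (1 + a ^ 2))) ^ 2 +
      (η + a * (x - (x - η * (v - a) / (1 + a ^ 2)))) ^ 2 =
      η ^ 2 * (1 + v ^ 2) / (1 + a ^ 2) := by
    field_simp
    ring
  simp only [hg]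
  rw [e1, e2]
  field_simp

/-- A bounded measurable function, continuous at `x₀`, is recovered as the limit of its Cauchy
averages along rescalings concentrating at `x₀`. -/
lemma tendsto_integral_cauchy_average {ι : Type*} {l : Filter ι} [l.IsCountablyGenerated]
    {G : ℝ → ℝ} {M x₀ a₀ : ℝ} (hG : Measurable G) (hM : ∀ t, |G t| ≤ M)
    (hcont : ContinuousAt G x₀) {x a η : ι → ℝ} (hx : Tendsto x l (𝓝 x₀))
    (ha : Tendsto a l (𝓝 a₀)) (hη : Tendsto η l (𝓝 0)) :
    Tendsto (fun i => ∫ v, G (x i - η i * (v - a i) / (1 + a i ^ 2)) * (1 + v ^ 2)⁻¹) l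
      (𝓝 (G x₀ * Real.pi)) := by
  rw [← integral_univ_inv_one_add_sq, ← integral_const_mul]
  refine tendsto_integral_filter_of_dominated_convergence (fun v => M * (1 + v ^ 2)⁻¹)
    (Eventually.of_forall fun i => ?_) (Eventually.of_forall fun i => ?_)
    (integrable_inv_one_add_sq.const_mul M) ?_
  · exact Measurable.aestronglyMeasurable (by fun_prop)
  · refine Eventually.of_forall fun v => ?_
    rw [norm_mul, Real.norm_eq_abs, Real.norm_of_nonneg (by positivity)]
    exact mul_le_mul_of_nonneg_right (hM _) (by positivity)
  · refine Eventually.of_forall fun v => ?_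
    refine Tendsto.mul_const _ (hcont.tendsto.comp ?_)
    have hd : (1 : ℝ) + a₀ ^ 2 ≠ 0 := by positivity
    have := hx.sub ((hη.mul (ha.const_sub v)).div ((ha.pow 2).const_add 1) hd)
    simpa using this

/-- the kernel `Ĩ₁` acts as an approximation to the identity:
`(1/π) ∫_{-1}^1 h(t) √(1+Ψ'(t)²) Ĩ₁(x,y,t) dt → h(x₀) √(1+Ψ'(x₀)²)`
as `(x,y) → (x₀, Ψ(x₀))` with `y > Ψ(x)`. -/
theorem stmt12 (Ψ h : ℝ → ℝ)
    (hΨ : ∃ V : Set ℝ, IsOpen V ∧ Set.Icc (-1 : ℝ) 1 ⊆ V ∧ AnalyticOnNhd ℝ Ψ V)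
    (hh : ContDiffOn ℝ 1 h (Set.Icc (-1 : ℝ) 1))
    (hne : ∃ t ∈ Set.Icc (-1 : ℝ) 1, h t ≠ 0)
    (x₀ : ℝ) (hx₀ : x₀ ∈ Set.Ioo (-1 : ℝ) 1) :
    Filter.Tendsto
      (fun p : ℝ × ℝ => (1 / Real.pi) * ∫ t in (-1 : ℝ)..1,
        h t * Real.sqrt (1 + deriv Ψ t ^ 2) *
          ((p.2 - Ψ p.1) /
            ((p.1 - t) ^ 2 + (p.2 - Ψ p.1 + deriv Ψ p.1 * (p.1 - t)) ^ 2)))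
      (𝓝[{p : ℝ × ℝ | p.1 ∈ Set.Ioo (-1 : ℝ) 1 ∧ Ψ p.1 < p.2}] (x₀, Ψ x₀))
      (𝓝 (h x₀ * Real.sqrt (1 + deriv Ψ x₀ ^ 2))) := by
  obtain ⟨V, -, hIV, hA⟩ := hΨ
  set l := 𝓝[{p : ℝ × ℝ | p.1 ∈ Set.Ioo (-1 : ℝ) 1 ∧ Ψ p.1 < p.2}] (x₀, Ψ x₀)
  have hx₀I : x₀ ∈ Icc (-1 : ℝ) 1 := Ioo_subset_Icc_self hx₀
  have hdΨ : ContinuousOn (deriv Ψ) (Icc (-1) 1) := hA.deriv.continuousOn.mono hIV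
  set F : ℝ → ℝ := fun t => h t * Real.sqrt (1 + deriv Ψ t ^ 2)
  have hFc : ContinuousOn F (Icc (-1) 1) :=
    hh.continuousOn.mul ((continuousOn_const.add (hdΨ.pow 2)).sqrt)
  set G : ℝ → ℝ := (Icc (-1 : ℝ) 1).indicator F with hG
  have hGm : Measurable G := by
    classical
    rw [hG, ← Set.piecewise_eq_indicator]
    exact hFc.measurable_piecewise continuousOn_const measurableSet_Icc
  obtain ⟨M, hM⟩ := isCompact_Icc.exists_bound_of_continuousOn hFc
  have hGM : ∀ t, |G t| ≤ M := by
    intro t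
    by_cases ht : t ∈ Icc (-1 : ℝ) 1
    · rw [hG, indicator_of_mem ht]
      exact hM t ht
    · rw [hG, indicator_of_notMem ht, abs_zero]
      exact (norm_nonneg _).trans (hM x₀ hx₀I)
  have hnhds : Icc (-1 : ℝ) 1 ∈ 𝓝 x₀ := Icc_mem_nhds hx₀.1 hx₀.2
  have hGc : ContinuousAt G x₀ := by
    refine (hFc.continuousAt hnhds).congr ?_
    filter_upwards [hnhds] with t ht
    rw [hG, indicator_of_mem ht]
  have hfst : Tendsto (fun p : ℝ × ℝ => p.1) l (𝓝 x₀) :=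
    continuous_fst.continuousAt.tendsto.mono_left nhdsWithin_le_nhds
  have hsnd : Tendsto (fun p : ℝ × ℝ => p.2) l (𝓝 (Ψ x₀)) :=
    continuous_snd.continuousAt.tendsto.mono_left nhdsWithin_le_nhds
  have hη : Tendsto (fun p : ℝ × ℝ => p.2 - Ψ p.1) l (𝓝 0) := by
    simpa using hsnd.sub ((hA x₀ (hIV hx₀I)).continuousAt.tendsto.comp hfst)
  have ha : Tendsto (fun p : ℝ × ℝ => deriv Ψ p.1) l (𝓝 (deriv Ψ x₀)) :=
    (hdΨ.continuousAt hnhds).tendsto.comp hfst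
  have key := (tendsto_integral_cauchy_average hGm hGM hGc hfst ha hη).const_mul (1 / Real.pi)
  have hlim : 1 / Real.pi * (G x₀ * Real.pi) = F x₀ := by
    rw [hG, indicator_of_mem hx₀I]
    field_simp
  rw [hlim] at key
  refine key.congr' ?_
  filter_upwards [self_mem_nhdsWithin] with p hp
  rw [← integral_mul_kernel_eq G _ _ _ (sub_pos.2 hp.2),
    intervalIntegral.integral_of_le (by norm_num), ← integral_Icc_eq_integral_Ioc,
    ← integral_indicator measurableSet_Icc]
  congr 2 with t
  exact (indicator_mul_left (Icc (-1 : ℝ) 1) F fun t => (p.2 - Ψ p.1) /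
    ((p.1 - t) ^ 2 + (p.2 - Ψ p.1 + deriv Ψ p.1 * (p.1 - t)) ^ 2)).symm
end

section
/- Let a > 0, let Ψ:[-a,a]→ℝ have a real analytic extension to an open neighbourhood of [-a,a], and let ψ ∈ C¹([-a,a]²). For x ∈ (-a,a) define I(x,t) := ψ(x,t)/(x−t), the symmetric excluded interval I_ε(x) := (x−ε, x+ε), and the curve-metric excluded set S_ε(x) := { t ∈ [-a,a] : |(x,Ψ(x)) − (t,Ψ(t))| < ε }. Then lim_{ε→0} ∫_{[-a,a]∖I_ε(x)} I(x,t) dt = lim_{ε→0} ∫_{[-a,a]∖S_ε(x)} I(x,t) dt, i.e. the Cauchy principal value is the same whether the singularity is excised by symmetric parameter intervals or by Euclidean balls on the curve. -/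
open MeasureTheory Filter Topology Set

/-- Over a set symmetric about `x`, the kernel `1 / (x - t)` has vanishing integral. -/
lemma setIntegral_inv_sub_eq_zero {x : ℝ} {s : Set ℝ} (hs : MeasurableSet s)
    (hsymm : ∀ t, 2 * x - t ∈ s ↔ t ∈ s) : ∫ t in s, 1 / (x - t) = 0 := by
  rw [← integral_indicator hs]
  have hodd : ∀ t, s.indicator (fun t => 1 / (x - t)) (2 * x - t)
      = -s.indicator (fun t => 1 / (x - t)) t := by
    intro t
    by_cases ht : t ∈ s
    · rw [indicator_of_mem ht, indicator_of_mem ((hsymm t).2 ht), ← one_div_neg_eq_neg_one_div]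
      congr 1
      ring
    · rw [indicator_of_notMem ht, indicator_of_notMem (mt (hsymm t).1 ht), neg_zero]
  have h := integral_sub_left_eq_self (s.indicator fun t => 1 / (x - t)) volume (2 * x)
  simp_rw [hodd, integral_neg] at h
  linarith

lemma integrableOn_div_sub {a x ε : ℝ} (hε : 0 < ε) {f : ℝ → ℝ} (hf : Continuous f) :
    IntegrableOn (fun t => f t / (x - t)) (Icc (-a) a \ Ioo (x - ε) (x + ε)) := by
  refine ContinuousOn.integrableOn_compact (isCompact_Icc.diff isOpen_Ioo) ?_
  refine hf.continuousOn.div (by fun_prop) ?_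
  rintro t ⟨-, ht⟩ h
  exact ht ⟨by linarith, by linarith⟩

/-- The truncated integrals of the kernel `1 / (x - t)` are constant for small truncations. -/
lemma setIntegral_inv_sub_eq {a x r ε : ℝ} (hr : Ioo (x - r) (x + r) ⊆ Icc (-a) a)
    (hε : 0 < ε) (hεr : ε ≤ r) :
    ∫ t in Icc (-a) a \ Ioo (x - ε) (x + ε), 1 / (x - t)
      = ∫ t in Icc (-a) a \ Ioo (x - r) (x + r), 1 / (x - t) := by
  have hunion : Icc (-a) a \ Ioo (x - ε) (x + ε)
      = (Icc (-a) a \ Ioo (x - r) (x + r)) ∪ (Ioo (x - r) (x + r) \ Ioo (x - ε) (x + ε)) := by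
    ext t
    by_cases h : t ∈ Ioo (x - r) (x + r)
    · have := hr h
      simp [h, this, -mem_Icc, -mem_Ioo]
    · have : t ∉ Ioo (x - ε) (x + ε) := fun h' => h ⟨by linarith [h'.1], by linarith [h'.2]⟩
      simp [h, this, -mem_Icc, -mem_Ioo]
  have hint : IntegrableOn (fun t => 1 / (x - t)) (Icc (-a) a \ Ioo (x - ε) (x + ε)) :=
    integrableOn_div_sub (f := fun _ => 1) hε continuous_const
  rw [hunion] at hint ⊢
  rw [setIntegral_union (disjoint_sdiff_left.mono_right sdiff_subset)
    (measurableSet_Ioo.diff measurableSet_Ioo) hint.left_of_union hint.right_of_union,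
    setIntegral_inv_sub_eq_zero (measurableSet_Ioo.diff measurableSet_Ioo), add_zero]
  intro t
  simp only [Set.mem_sdiff, mem_Ioo]
  constructor <;> rintro ⟨⟨h1, h2⟩, h3⟩ <;>
    exact ⟨⟨by linarith, by linarith⟩, fun h => h3 ⟨by linarith [h.2], by linarith [h.1]⟩⟩

/-- Existence of the principal value with symmetric excision. -/
lemma exists_tendsto_setIntegral_div_sub {a x : ℝ} (hx : x ∈ Ioo (-a) a) {f : ℝ → ℝ}
    (hf : Continuous f) (hfx : DifferentiableAt ℝ f x) :
    ∃ L : ℝ, Tendsto (fun ε : ℝ => ∫ t in Icc (-a) a \ Ioo (x - ε) (x + ε), f t / (x - t))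
      (𝓝[>] 0) (𝓝 L) := by
  obtain ⟨r, hr0, hr⟩ : ∃ r > 0, Ioo (x - r) (x + r) ⊆ Icc (-a) a := by
    obtain ⟨r, hr0, hr⟩ := Metric.mem_nhds_iff.1 (Icc_mem_nhds hx.1 hx.2)
    exact ⟨r, hr0, by rwa [Real.ball_eq_Ioo] at hr⟩
  have hg : Continuous (dslope f x) := by
    rw [← continuousOn_univ, continuousOn_dslope univ_mem]
    exact ⟨hf.continuousOn, hfx⟩
  have hgint : IntegrableOn (dslope f x) (Icc (-a) a) :=
    hg.continuousOn.integrableOn_compact isCompact_Icc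
  have hE : ∀ ε : ℝ, MeasurableSet (Icc (-a) a \ Ioo (x - ε) (x + ε)) :=
    fun ε => measurableSet_Icc.diff measurableSet_Ioo
  have hlim : Tendsto (fun ε : ℝ => ∫ t in Icc (-a) a \ Ioo (x - ε) (x + ε), dslope f x t)
      (𝓝[>] 0) (𝓝 (∫ t in Icc (-a) a, dslope f x t)) := by
    simp_rw [← integral_indicator (hE _), ← integral_indicator measurableSet_Icc]
    refine tendsto_integral_filter_of_dominated_convergence
      (fun t => ‖(Icc (-a) a).indicator (dslope f x) t‖)
      (Eventually.of_forall fun ε => (hg.measurable.indicator (hE ε)).aestronglyMeasurable)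
      (Eventually.of_forall fun ε => Eventually.of_forall fun t =>
        norm_indicator_le_of_subset sdiff_subset _ _)
      ((integrable_indicator_iff measurableSet_Icc).2 hgint).norm ?_
    filter_upwards [Measure.ae_ne volume x] with t ht
    refine tendsto_const_nhds.congr' ?_
    have hpos : 0 < |t - x| := abs_pos.2 (sub_ne_zero.2 ht)
    filter_upwards [Ioo_mem_nhdsGT hpos] with ε hε
    have hnot : t ∉ Ioo (x - ε) (x + ε) := by
      intro h
      have : |t - x| < ε := abs_lt.2 ⟨by linarith [h.1], by linarith [h.2]⟩
      exact absurd hε.2 this.not_gt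
    by_cases h : t ∈ Icc (-a) a
    · rw [indicator_of_mem h, indicator_of_mem (s := Icc (-a) a \ Ioo (x - ε) (x + ε)) ⟨h, hnot⟩]
    · rw [indicator_of_notMem h, indicator_of_notMem fun h' => h h'.1]
  refine ⟨_, (hlim.const_sub
    (f x * ∫ t in Icc (-a) a \ Ioo (x - r) (x + r), 1 / (x - t))).congr' ?_⟩
  filter_upwards [Ioo_mem_nhdsGT hr0] with ε hε
  rw [← setIntegral_inv_sub_eq hr hε.1 hε.2.le, ← integral_const_mul, ← integral_sub]
  · refine setIntegral_congr_fun (hE ε) fun t ht => ?_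
    have htx : t ≠ x := by
      rintro rfl
      exact ht.2 ⟨by linarith [hε.1], by linarith [hε.1]⟩
    have h1 : x - t ≠ 0 := sub_ne_zero.2 htx.symm
    have h2 : t - x ≠ 0 := sub_ne_zero.2 htx
    simp only [dslope_of_ne f htx, slope_def_field]
    field_simp
    ring
  · exact (integrableOn_div_sub (f := fun _ => 1) hε.1 continuous_const).const_mul _
  · exact hgint.mono_set sdiff_subset

/-- If `d t ~ m |t - x|` at `x`, the integral over the part of the interval of radius `ε` on which
`ε ≤ d` tends to zero with `ε`. -/
lemma tendsto_setIntegral_Ioo_inter {x m : ℝ} {f d : ℝ → ℝ} (hf : Continuous f)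
    (hd : Continuous d) (hm : Tendsto (fun t => d t / |t - x|) (𝓝[≠] x) (𝓝 m)) (hdx : d x = 0) :
    Tendsto (fun ε : ℝ => ∫ t in Ioo (x - ε) (x + ε) ∩ {t | ε ≤ d t}, f t / (x - t))
      (𝓝[>] 0) (𝓝 0) := by
  set F : ℝ → ℝ → ℝ := fun ε =>
    (Ioo (-1) 1 ∩ {s | ε ≤ d (x + ε * s)}).indicator fun s => f (x + ε * s) / -s with hF
  set G : ℝ → ℝ := (Ioo (-1) 1 ∩ {s | 1 ≤ m * |s|}).indicator fun s => f x / -s with hG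
  have hGm : MeasurableSet (Ioo (-1 : ℝ) 1 ∩ {s | 1 ≤ m * |s|}) :=
    measurableSet_Ioo.inter (measurableSet_le measurable_const (by fun_prop))
  have hFm : ∀ ε, MeasurableSet (Ioo (-1 : ℝ) 1 ∩ {s | ε ≤ d (x + ε * s)}) := fun ε =>
    measurableSet_Ioo.inter (measurableSet_le measurable_const (by fun_prop))
  have hG0 : ∫ s, G s = 0 := by
    have h := setIntegral_inv_sub_eq_zero (x := 0) hGm (by
      intro t
      simp only [mem_inter_iff, mem_Ioo, mem_ofPred_eq, mul_zero, zero_sub, abs_neg]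
      constructor <;> rintro ⟨⟨h1, h2⟩, h3⟩ <;> exact ⟨⟨by linarith, by linarith⟩, h3⟩)
    rw [hG, integral_indicator hGm]
    simp_rw [div_eq_mul_one_div (f x)]
    rw [integral_const_mul]
    simp only [zero_sub] at h
    rw [h, mul_zero]
  have hscale : ∀ ε > 0, ∫ t in Ioo (x - ε) (x + ε) ∩ {t | ε ≤ d t}, f t / (x - t)
      = ∫ s, F ε s := by
    intro ε hε
    rw [← integral_indicator
      (measurableSet_Ioo.inter (measurableSet_le measurable_const hd.measurable)),
      ← integral_add_left_eq_self _ x]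
    have h := Measure.integral_comp_mul_left (fun s => (Ioo (x - ε) (x + ε) ∩
      {t | ε ≤ d t}).indicator (fun t => f t / (x - t)) (x + s)) ε
    rw [abs_of_pos (inv_pos.2 hε), smul_eq_mul, eq_inv_mul_iff_mul_eq₀ hε.ne'] at h
    rw [← h, ← integral_const_mul]
    congr 1 with s
    have hiff : x + ε * s ∈ Ioo (x - ε) (x + ε) ∩ {t | ε ≤ d t} ↔
        s ∈ Ioo (-1) 1 ∩ {s | ε ≤ d (x + ε * s)} := by
      simp only [mem_inter_iff, mem_Ioo, mem_ofPred_eq]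
      refine and_congr_left fun _ => and_congr ?_ ?_ <;> constructor <;> intro h <;> nlinarith
    by_cases hs : s ∈ Ioo (-1) 1 ∩ {s | ε ≤ d (x + ε * s)}
    · simp only [hF]
      rw [indicator_of_mem hs, indicator_of_mem (hiff.2 hs)]
      rw [sub_add_cancel_left, ← mul_neg, mul_div_assoc', mul_div_mul_left _ _ hε.ne']
    · simp only [hF]
      rw [indicator_of_notMem hs, indicator_of_notMem (mt hiff.1 hs), mul_zero]
  have hbound : ∀ᶠ t in 𝓝 x, |f t| ≤ |f x| + 1 ∧ d t ≤ (|m| + 1) * |t - x| := by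
    refine (hf.abs.continuousAt.eventually_le_const (lt_add_one |f x|)).and ?_
    have h := hm.eventually_le_const (show m < |m| + 1 by linarith [le_abs_self m])
    filter_upwards [eventually_nhdsWithin_iff.1 h] with t ht
    by_cases htx : t = x
    · simp [htx, hdx]
    · exact (div_le_iff₀ (abs_pos.2 (sub_ne_zero.2 htx))).1 (ht htx)
  obtain ⟨r, hr0, hr⟩ := Metric.eventually_nhds_iff_ball.1 hbound
  have key : Tendsto (fun ε => ∫ s, F ε s) (𝓝[>] 0) (𝓝 (∫ s, G s)) := by
    refine tendsto_integral_filter_of_dominated_convergence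
      ((Ioo (-1 : ℝ) 1).indicator fun _ => (|f x| + 1) * (|m| + 1)) ?_ ?_ ?_ ?_
    · refine Eventually.of_forall fun ε => Measurable.aestronglyMeasurable ?_
      exact Measurable.indicator (by fun_prop) (hFm ε)
    · filter_upwards [Ioo_mem_nhdsGT hr0] with ε hε
      refine Eventually.of_forall fun s => ?_
      by_cases hs : s ∈ Ioo (-1) 1 ∩ {s | ε ≤ d (x + ε * s)}
      · simp only [hF]
        rw [indicator_of_mem hs, indicator_of_mem hs.1, norm_div, norm_neg, Real.norm_eq_abs,
          Real.norm_eq_abs]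
        have hs1 : |s| < 1 := abs_lt.2 hs.1
        have hdist : |x + ε * s - x| = ε * |s| := by
          rw [add_sub_cancel_left, abs_mul, abs_of_pos hε.1]
        obtain ⟨h1, h2⟩ := hr (x + ε * s) (by
          rw [Metric.mem_ball, Real.dist_eq, hdist]
          nlinarith [hε.1, hε.2])
        rw [hdist] at h2
        have h3 : 1 ≤ (|m| + 1) * |s| := by
          have h4 : ε ≤ d (x + ε * s) := hs.2
          have h5 : ε * 1 ≤ ε * ((|m| + 1) * |s|) := by linarith
          exact le_of_mul_le_mul_left h5 hε.1
        have hs0 : 0 < |s| := by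
          by_contra! h
          nlinarith [abs_nonneg m]
        rw [div_le_iff₀ hs0]
        nlinarith [abs_nonneg (f x)]
      · simp only [hF]
        rw [indicator_of_notMem hs, norm_zero]
        exact indicator_nonneg (fun _ _ => by positivity) s
    · exact (integrable_indicator_iff measurableSet_Ioo).2 (integrableOn_const (by simp))
    · have hne : ∀ᵐ s : ℝ, m * |s| ≠ 1 := by
        have : {s : ℝ | m * |s| = 1} ⊆ {m⁻¹, -m⁻¹} := by
          intro s hs
          have h : |s| = m⁻¹ := eq_inv_of_mul_eq_one_right hs
          rcases abs_choice s with h' | h'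
          · left; rw [← h, h']
          · right; rw [mem_singleton_iff, ← h, h', neg_neg]
        exact measure_mono_null (fun s hs => this (not_not.1 hs)) ((toFinite {m⁻¹, -m⁻¹}).measure_zero volume)
      filter_upwards [Measure.ae_ne volume (0 : ℝ), hne] with s hs0 hsm
      have hpath : Tendsto (fun ε : ℝ => x + ε * s) (𝓝[>] 0) (𝓝 x) :=
        ((by fun_prop : Continuous fun ε : ℝ => x + ε * s).tendsto' 0 x (by simp)).mono_left
          nhdsWithin_le_nhds
      have hpath' : Tendsto (fun ε : ℝ => x + ε * s) (𝓝[>] 0) (𝓝[≠] x) := by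
        refine tendsto_nhdsWithin_iff.2 ⟨hpath, ?_⟩
        filter_upwards [self_mem_nhdsWithin] with ε hε
        simpa using ⟨ne_of_gt hε, hs0⟩
      have hratio : Tendsto (fun ε : ℝ => d (x + ε * s) / ε) (𝓝[>] 0) (𝓝 (m * |s|)) := by
        refine ((hm.comp hpath').mul_const |s|).congr' ?_
        filter_upwards [self_mem_nhdsWithin] with ε hε
        have h0 : |s| ≠ 0 := abs_ne_zero.2 hs0
        simp only [Function.comp_apply]
        rw [add_sub_cancel_left, abs_mul, abs_of_pos (mem_Ioi.1 hε)]
        have := ne_of_gt (mem_Ioi.1 hε)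
        field_simp
      have hval : Tendsto (fun ε : ℝ => f (x + ε * s) / -s) (𝓝[>] 0) (𝓝 (f x / -s)) :=
        ((hf.tendsto x).comp hpath).div_const _
      have hmem : ∀ᶠ ε in 𝓝[>] (0 : ℝ), (s ∈ Ioo (-1) 1 ∩ {s | ε ≤ d (x + ε * s)} ↔
          s ∈ Ioo (-1) 1 ∩ {s | 1 ≤ m * |s|}) := by
        rcases hsm.lt_or_gt with h | h
        · filter_upwards [hratio.eventually_lt_const h, self_mem_nhdsWithin] with ε h1 hε
          rw [div_lt_one hε] at h1
          simp [h1.not_ge, h.not_ge]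
        · filter_upwards [hratio.eventually_const_lt h, self_mem_nhdsWithin] with ε h1 hε
          rw [one_lt_div hε] at h1
          simp [h1.le, h.le]
      by_cases hs : s ∈ Ioo (-1) 1 ∩ {s | 1 ≤ m * |s|}
      · simp only [hG]
        rw [indicator_of_mem hs]
        refine hval.congr' ?_
        filter_upwards [hmem] with ε h
        exact (indicator_of_mem (h.2 hs) fun s => f (x + ε * s) / -s).symm
      · simp only [hG]
        rw [indicator_of_notMem hs]
        refine tendsto_const_nhds.congr' ?_
        filter_upwards [hmem] with ε h
        exact (indicator_of_notMem (mt h.1 hs) fun s => f (x + ε * s) / -s).symm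
  rw [hG0] at key
  refine key.congr' ?_
  filter_upwards [self_mem_nhdsWithin] with ε hε
  exact (hscale ε hε).symm

/-- Replacing symmetric excision by excision of the sublevel sets of a function `d` that is
asymptotically proportional to the distance to `x` does not change the principal value. -/
lemma tendsto_setIntegral_div_sub_of_dist_le {a x m L : ℝ} (hx : x ∈ Ioo (-a) a) {f d : ℝ → ℝ}
    (hf : Continuous f) (hd : Continuous d)
    (hm : Tendsto (fun t => d t / |t - x|) (𝓝[≠] x) (𝓝 m)) (hdx : d x = 0)
    (hle : ∀ t ∈ Icc (-a) a, |t - x| ≤ d t)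
    (hL : Tendsto (fun ε : ℝ => ∫ t in Icc (-a) a \ Ioo (x - ε) (x + ε), f t / (x - t))
      (𝓝[>] 0) (𝓝 L)) :
    Tendsto (fun ε : ℝ => ∫ t in {t ∈ Icc (-a) a | ε ≤ d t}, f t / (x - t)) (𝓝[>] 0) (𝓝 L) := by
  have hsum := hL.add (tendsto_setIntegral_Ioo_inter hf hd hm hdx)
  rw [add_zero] at hsum
  refine hsum.congr' ?_
  obtain ⟨r, hr0, hr⟩ := Metric.mem_nhds_iff.1 (Icc_mem_nhds hx.1 hx.2)
  rw [Real.ball_eq_Ioo] at hr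
  filter_upwards [Ioo_mem_nhdsGT hr0] with ε hε
  have hunion : {t ∈ Icc (-a) a | ε ≤ d t}
      = (Icc (-a) a \ Ioo (x - ε) (x + ε)) ∪ (Ioo (x - ε) (x + ε) ∩ {t | ε ≤ d t}) := by
    ext t
    by_cases h : t ∈ Ioo (x - ε) (x + ε)
    · have : t ∈ Icc (-a) a := hr ⟨by linarith [h.1, hε.2], by linarith [h.2, hε.2]⟩
      simp [h, this, -mem_Icc, -mem_Ioo]
    · have h' : t ∈ Icc (-a) a → ε ≤ d t := fun ht => by
        refine le_trans ?_ (hle t ht)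
        by_contra! hlt
        exact h ⟨by linarith [(abs_lt.1 hlt).1], by linarith [(abs_lt.1 hlt).2]⟩
      simpa [h, -mem_Icc, -mem_Ioo] using h'
  -- `d` is small near `x`, so the excised set contains an interval about `x`.
  obtain ⟨δ, hδ0, hδ⟩ := Metric.eventually_nhds_iff_ball.1
    (hd.continuousAt.eventually_lt_const (show d x < ε by rw [hdx]; exact hε.1))
  rw [Real.ball_eq_Ioo] at hδ
  have hint : IntegrableOn (fun t => f t / (x - t)) {t ∈ Icc (-a) a | ε ≤ d t} :=
    (integrableOn_div_sub hδ0 hf).mono_set fun t ht =>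
      ⟨ht.1, fun h => (hδ t h).not_ge ht.2⟩
  rw [hunion] at hint ⊢
  exact (setIntegral_union (disjoint_sdiff_left.mono_right inter_subset_left)
    (measurableSet_Ioo.inter (measurableSet_le measurable_const hd.measurable))
    hint.left_of_union hint.right_of_union).symm

/-- The chord of a graph is asymptotically proportional to the increment of the parameter. -/
lemma tendsto_sqrt_add_sq_div_abs {Ψ : ℝ → ℝ} {x p : ℝ} (h : HasDerivAt Ψ p x) :
    Tendsto (fun t => √((x - t) ^ 2 + (Ψ x - Ψ t) ^ 2) / |t - x|) (𝓝[≠] x)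
      (𝓝 √(1 + p ^ 2)) := by
  refine (((hasDerivAt_iff_tendsto_slope.1 h).pow 2).const_add 1).sqrt.congr' ?_
  filter_upwards [self_mem_nhdsWithin] with t ht
  have h0 : t - x ≠ 0 := sub_ne_zero.2 ht
  rw [← Real.sqrt_sq_eq_abs, ← Real.sqrt_div (by positivity), slope_def_field]
  congr 1
  field_simp
  ring

/-- the principal value does not depend on the excision scheme.
For `ψ ∈ C¹([-a,a]²)`, `Ψ` real analytic near `[-a,a]`, and `x ∈ (-a,a)`, the principal values of
`∫ ψ(x,t)/(x−t) dt` obtained by removing the symmetric parameter intervals `I_ε(x) = (x−ε,x+ε)`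
or the curve-metric sets `S_ε(x) = {t : |(x,Ψ(x))−(t,Ψ(t))| < ε}` both exist and coincide. -/
theorem stmt14 (a : ℝ) (ha : 0 < a) (Ψ : ℝ → ℝ)
    (hΨ : ∃ V : Set ℝ, IsOpen V ∧ Set.Icc (-a) a ⊆ V ∧ AnalyticOnNhd ℝ Ψ V)
    (ψ : ℝ × ℝ → ℝ)
    (hψ : ContDiffOn ℝ 1 ψ (Set.Icc (-a) a ×ˢ Set.Icc (-a) a))
    (x : ℝ) (hx : x ∈ Set.Ioo (-a) a) :
    ∃ L : ℝ,
      Filter.Tendsto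
        (fun ε : ℝ => ∫ t in Set.Icc (-a) a \ Set.Ioo (x - ε) (x + ε), ψ (x, t) / (x - t))
        (𝓝[>] (0 : ℝ)) (𝓝 L) ∧
      Filter.Tendsto
        (fun ε : ℝ => ∫ t in {t ∈ Set.Icc (-a) a |
            ε ≤ Real.sqrt ((x - t) ^ 2 + (Ψ x - Ψ t) ^ 2)}, ψ (x, t) / (x - t))
        (𝓝[>] (0 : ℝ)) (𝓝 L) := by
  have haa : -a ≤ a := by linarith
  have hxI : x ∈ Icc (-a) a := Ioo_subset_Icc_self hx
  have hnhds : Icc (-a) a ∈ 𝓝 x := Icc_mem_nhds hx.1 hx.2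
  obtain ⟨P, hPc, hPmem, hPid⟩ : ∃ P : ℝ → ℝ,
      Continuous P ∧ (∀ t, P t ∈ Icc (-a) a) ∧ ∀ t ∈ Icc (-a) a, P t = t :=
    ⟨fun t => projIcc (-a) a haa t, continuous_subtype_val.comp continuous_projIcc,
      fun t => (projIcc (-a) a haa t).2, fun t ht => by simp [projIcc_of_mem haa ht]⟩
  obtain ⟨V, -, hV, hΨV⟩ := hΨ
  have hfc : Continuous fun t => ψ (x, P t) :=
    hψ.continuousOn.comp_continuous (by fun_prop) fun t => ⟨hxI, hPmem t⟩
  have hfd : DifferentiableAt ℝ (fun t => ψ (x, P t)) x := by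
    have h1 : DifferentiableAt ℝ ψ (x, x) :=
      (hψ.contDiffAt (prod_mem_nhds hnhds hnhds)).differentiableAt one_ne_zero
    have h2 : DifferentiableAt ℝ (fun t => ψ (x, t)) x :=
      h1.comp x ((differentiableAt_const x).prodMk differentiableAt_id)
    refine h2.congr_of_eventuallyEq ?_
    filter_upwards [hnhds] with t ht
    rw [hPid t ht]
  have hΨc : Continuous fun t => Ψ (P t) :=
    hΨV.continuousOn.comp_continuous hPc fun t => hV (hPmem t)
  have hdc : Continuous fun t => √((x - t) ^ 2 + (Ψ (P x) - Ψ (P t)) ^ 2) :=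
    (((continuous_const.sub continuous_id).pow 2).add ((continuous_const.sub hΨc).pow 2)).sqrt
  have hΨd : HasDerivAt (fun t => Ψ (P t)) (deriv Ψ x) x := by
    refine (hΨV x (hV hxI)).differentiableAt.hasDerivAt.congr_of_eventuallyEq ?_
    filter_upwards [hnhds] with t ht
    rw [hPid t ht]
  obtain ⟨L, hL⟩ := exists_tendsto_setIntegral_div_sub hx hfc hfd
  have hm : Tendsto (fun t => √((x - t) ^ 2 + (Ψ (P x) - Ψ (P t)) ^ 2) / |t - x|) (𝓝[≠] x)
      (𝓝 √(1 + deriv Ψ x ^ 2)) :=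
    tendsto_sqrt_add_sq_div_abs (Ψ := fun t => Ψ (P t)) hΨd
  have hle : ∀ t ∈ Icc (-a) a, |t - x| ≤ √((x - t) ^ 2 + (Ψ (P x) - Ψ (P t)) ^ 2) :=
    fun t _ => Real.abs_le_sqrt (by nlinarith [sq_nonneg (Ψ (P x) - Ψ (P t))])
  have hL' := tendsto_setIntegral_div_sub_of_dist_le
    (d := fun t => √((x - t) ^ 2 + (Ψ (P x) - Ψ (P t)) ^ 2)) hx hfc hdc
    hm (by simp) hle hL
  refine ⟨L, hL.congr fun ε => ?_, hL'.congr fun ε => ?_⟩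
  · refine setIntegral_congr_fun (measurableSet_Icc.diff measurableSet_Ioo) fun t ht => ?_
    simp only [hPid t ht.1]
  · have hset : {t ∈ Icc (-a) a | ε ≤ √((x - t) ^ 2 + (Ψ (P x) - Ψ (P t)) ^ 2)}
        = {t ∈ Icc (-a) a | ε ≤ √((x - t) ^ 2 + (Ψ x - Ψ t) ^ 2)} := by
      ext t
      refine and_congr_right fun ht => ?_
      rw [hPid t ht, hPid x hxI]
    rw [← hset]
    refine setIntegral_congr_fun (measurableSet_Icc.inter
      (measurableSet_le measurable_const hdc.measurable)) fun t ht => ?_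
    simp only [hPid t ht.1]
end

section
/- Let 0 < a < r and M > 0, and let z₁, z₂ ∈ ℂ satisfy |z₁| < a and |z₂| < (r−a)²/(2Mr). Then (r−z₁)² − 2Mr z₂ does not lie on the closed negative real half-axis (−∞,0]; consequently, choosing the principal branch of the square root, the function (z₁,z₂) ↦ √((r−z₁)² − 2Mr z₂) is complex analytic in each variable separately on the polydisc D(0,a) × D(0,(r−a)²/(2Mr)). -/
open Filter Topology Set Metric

/-- If `Re s > d ≥ 0` and `‖c‖ < d ^ 2`, then `s ^ 2 - c` lies in the slit plane. -/
theorem sq_sub_mem_slitPlane {d : ℝ} {s c : ℂ} (hd : 0 ≤ d) (hs : d < s.re)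
    (hc : ‖c‖ < d ^ 2) : s ^ 2 - c ∈ Complex.slitPlane := by
  rw [Complex.mem_slitPlane_iff]
  by_contra! h
  obtain ⟨hre, him⟩ := h
  simp only [pow_two, Complex.sub_re, Complex.sub_im, Complex.mul_re, Complex.mul_im] at hre him
  have hnorm : c.re ^ 2 + c.im ^ 2 < (d ^ 2) ^ 2 := by
    have h1 : ‖c‖ ^ 2 < (d ^ 2) ^ 2 := pow_lt_pow_left₀ hc (norm_nonneg c) two_ne_zero
    rw [Complex.sq_norm, Complex.normSq_apply] at h1
    linarith
  have hx : d ^ 2 < s.re ^ 2 := pow_lt_pow_left₀ hs hd two_ne_zero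
  have hx4 : (d ^ 2) ^ 2 < (s.re ^ 2) ^ 2 := pow_lt_pow_left₀ hx (sq_nonneg d) two_ne_zero
  have hq : c.im ^ 2 = 4 * (s.re ^ 2 * s.im ^ 2) := by
    rw [show c.im = 2 * (s.re * s.im) by linarith]
    ring
  rcases le_total (s.re ^ 2) (s.im ^ 2) with hxy | hxy
  · nlinarith [mul_le_mul_of_nonneg_left hxy (sq_nonneg s.re), sq_nonneg c.re]
  · have hp : (s.re ^ 2 - s.im ^ 2) ^ 2 ≤ c.re ^ 2 :=
      pow_le_pow_left₀ (sub_nonneg.2 hxy) (by linarith) 2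
    nlinarith [mul_nonneg (sq_nonneg s.re) (sq_nonneg s.im), sq_nonneg (s.im ^ 2)]

/-- the argument of the square root avoids the negative real axis.
For `0 < a < r`, `M > 0`, `|z₁| < a` and `|z₂| < (r−a)²/(2Mr)`, the quantity
`(r−z₁)² − 2Mr z₂` does not lie on `(−∞,0]`; consequently the principal square root
`(z₁,z₂) ↦ √((r−z₁)² − 2Mr z₂)` is complex analytic in each variable separately on
`D(0,a) × D(0,(r−a)²/(2Mr))`. -/
theorem stmt15 (a r M : ℝ) (ha : 0 < a) (har : a < r) (hM : 0 < M)
    (z₁ z₂ : ℂ) (hz₁ : ‖z₁‖ < a) (hz₂ : ‖z₂‖ < (r - a) ^ 2 / (2 * M * r)) :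
    ¬ ((((r : ℂ) - z₁) ^ 2 - 2 * (M : ℂ) * (r : ℂ) * z₂).im = 0 ∧
        (((r : ℂ) - z₁) ^ 2 - 2 * (M : ℂ) * (r : ℂ) * z₂).re ≤ 0) ∧
      (∀ w : ℂ, ‖w‖ < (r - a) ^ 2 / (2 * M * r) →
        DifferentiableOn ℂ
          (fun z : ℂ => (((r : ℂ) - z) ^ 2 - 2 * (M : ℂ) * (r : ℂ) * w) ^ ((1 : ℂ) / 2))
          (Metric.ball (0 : ℂ) a)) ∧
      (∀ z : ℂ, ‖z‖ < a →
        DifferentiableOn ℂ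
          (fun w : ℂ => (((r : ℂ) - z) ^ 2 - 2 * (M : ℂ) * (r : ℂ) * w) ^ ((1 : ℂ) / 2))
          (Metric.ball (0 : ℂ) ((r - a) ^ 2 / (2 * M * r)))) := by
  have hmem : ∀ z w : ℂ, ‖z‖ < a → ‖w‖ < (r - a) ^ 2 / (2 * M * r) →
      ((r : ℂ) - z) ^ 2 - 2 * (M : ℂ) * (r : ℂ) * w ∈ Complex.slitPlane := by
    intro z w hz hw
    have hr : 0 < r := ha.trans har
    refine sq_sub_mem_slitPlane (sub_nonneg.2 har.le) ?_ ?_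
    · rw [Complex.sub_re, Complex.ofReal_re]
      linarith [Complex.re_le_norm z]
    · have hK : 0 < 2 * M * r := by positivity
      rw [lt_div_iff₀ hK] at hw
      simpa [abs_of_pos hM, abs_of_pos hr, mul_comm] using hw
  refine ⟨fun ⟨him, hre⟩ => ?_, fun w hw => ?_, fun z hz => ?_⟩
  · rcases Complex.mem_slitPlane_iff.1 (hmem z₁ z₂ hz₁ hz₂) with h | h
    · exact hre.not_gt h
    · exact h him
  · exact DifferentiableOn.cpow_const (by fun_prop)
      fun z hz => hmem z w (mem_ball_zero_iff.1 hz) hw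
  · exact DifferentiableOn.cpow_const (by fun_prop)
      fun w hw => hmem z w hz (mem_ball_zero_iff.1 hw)
end

section
/- Let (a_n)_{n≥0} be a sequence of complex numbers with a₀ ≠ 0, and define (b_n)_{n≥0} by b₀ = i and b_n = −(1/a₀) ∑_{k=1}^{n} a_k b_{n−k} for n ≥ 1. Then for every n ≥ 1, |b_n| ≤ (1/|a₀|ⁿ) · ( ∑_{j=0}^{n} |a_j| )ⁿ. Consequently, if ∑_{n=0}^{∞} |a_n| < ∞, then sup_{n≥1} |b_n|^{1/n} ≤ (1/|a₀|) ∑_{n=0}^{∞} |a_n|. -/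
open Finset

/-- If `R ≥ 1` and `R * ‖a 0‖` dominates `∑_{k=1}^N ‖a k‖`, then `‖b n‖ ≤ R ^ n` for `n ≤ N`. -/
theorem norm_le_pow_of_reciprocal_recurrence (a b : ℕ → ℂ) (ha0 : a 0 ≠ 0) (hb0 : ‖b 0‖ ≤ 1)
    (hrec : ∀ n : ℕ, 1 ≤ n → b n = -(1 / a 0) * ∑ k ∈ Finset.Icc 1 n, a k * b (n - k))
    {R : ℝ} (hR : 1 ≤ R) {N : ℕ} (hS : ∑ k ∈ Finset.Icc 1 N, ‖a k‖ ≤ R * ‖a 0‖)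
    (n : ℕ) (hn : n ≤ N) : ‖b n‖ ≤ R ^ n := by
  induction n using Nat.strong_induction_on with
  | _ n ih =>
    have ha : 0 < ‖a 0‖ := norm_pos_iff.mpr ha0
    rcases Nat.eq_zero_or_pos n with rfl | hpos
    · simpa using hb0
    have hsum : ‖∑ k ∈ Finset.Icc 1 n, a k * b (n - k)‖ ≤ R * ‖a 0‖ * R ^ (n - 1) := by
      calc ‖∑ k ∈ Finset.Icc 1 n, a k * b (n - k)‖
          ≤ ∑ k ∈ Finset.Icc 1 n, ‖a k‖ * R ^ (n - 1) := by
            refine norm_sum_le_of_le _ fun k hk => ?_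
            rw [Finset.mem_Icc] at hk
            rw [norm_mul]
            gcongr
            exact (ih (n - k) (by omega) (by omega)).trans
              (pow_le_pow_right₀ hR (by omega))
        _ = (∑ k ∈ Finset.Icc 1 n, ‖a k‖) * R ^ (n - 1) := by rw [Finset.sum_mul]
        _ ≤ R * ‖a 0‖ * R ^ (n - 1) := by
            gcongr
            refine le_trans ?_ hS
            exact Finset.sum_le_sum_of_subset_of_nonneg (Finset.Icc_subset_Icc_right hn)
              fun _ _ _ => norm_nonneg _
    rw [hrec n hpos, norm_mul, norm_neg, norm_div, norm_one]
    calc 1 / ‖a 0‖ * ‖∑ k ∈ Finset.Icc 1 n, a k * b (n - k)‖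
        ≤ 1 / ‖a 0‖ * (R * ‖a 0‖ * R ^ (n - 1)) := by gcongr
      _ = R * R ^ (n - 1) := by field_simp
      _ = R ^ n := mul_pow_sub_one hpos.ne' R

/-- Hadamard-type bound on the reciprocal-series coefficients.
If `b₀ = i` and `bₙ = −(1/a₀) ∑_{k=1}^n aₖ b_{n−k}` for `n ≥ 1`, then for every `n ≥ 1`,
`|bₙ| ≤ (1/|a₀|ⁿ)(∑_{j=0}^n |aⱼ|)ⁿ`; consequently, if `∑ |aₙ| < ∞` then
`sup_{n≥1} |bₙ|^{1/n} ≤ (1/|a₀|) ∑_{n=0}^∞ |aₙ|`. -/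
theorem stmt18 (a b : ℕ → ℂ) (ha0 : a 0 ≠ 0) (hb0 : b 0 = Complex.I)
    (hrec : ∀ n : ℕ, 1 ≤ n → b n = -(1 / a 0) * ∑ k ∈ Finset.Icc 1 n, a k * b (n - k)) :
    (∀ n : ℕ, 1 ≤ n →
      ‖b n‖ ≤ (1 / ‖a 0‖ ^ n) * (∑ j ∈ Finset.range (n + 1), ‖a j‖) ^ n) ∧
    (Summable (fun n : ℕ => ‖a n‖) →
      ∀ n : ℕ, 1 ≤ n → ‖b n‖ ^ ((n : ℝ)⁻¹) ≤ (1 / ‖a 0‖) * ∑' n : ℕ, ‖a n‖) := by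
  have ha : 0 < ‖a 0‖ := norm_pos_iff.mpr ha0
  have main : ∀ n : ℕ, 1 ≤ n →
      ‖b n‖ ≤ (1 / ‖a 0‖ ^ n) * (∑ j ∈ Finset.range (n + 1), ‖a j‖) ^ n := by
    intro n _
    have hR : 1 ≤ (∑ j ∈ Finset.range (n + 1), ‖a j‖) / ‖a 0‖ := by
      rw [one_le_div ha]
      exact Finset.single_le_sum (f := fun j => ‖a j‖) (fun _ _ => norm_nonneg _)
        (Finset.mem_range.mpr n.succ_pos)
    have hS : ∑ k ∈ Finset.Icc 1 n, ‖a k‖ ≤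
        (∑ j ∈ Finset.range (n + 1), ‖a j‖) / ‖a 0‖ * ‖a 0‖ := by
      rw [div_mul_cancel₀ _ ha.ne']
      refine Finset.sum_le_sum_of_subset_of_nonneg (fun k hk => ?_) fun _ _ _ => norm_nonneg _
      rw [Finset.mem_Icc] at hk
      exact Finset.mem_range.mpr (by omega)
    have h := norm_le_pow_of_reciprocal_recurrence a b ha0 (by simp [hb0]) hrec hR hS n le_rfl
    rwa [div_pow, div_eq_mul_one_div, mul_comm] at h
  refine ⟨main, fun hs n hn => ?_⟩
  have hT : 0 ≤ ∑' n : ℕ, ‖a n‖ := tsum_nonneg fun _ => norm_nonneg _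
  rw [Real.rpow_inv_le_iff_of_pos (norm_nonneg _) (by positivity) (by exact_mod_cast hn),
    Real.rpow_natCast, mul_pow, one_div_pow]
  refine (main n hn).trans ?_
  gcongr
  exact hs.sum_le_tsum _ fun _ _ => norm_nonneg _
end

section
/- Let Ω ⊂ ℝ² be open, bounded and simply connected with real analytic boundary ∂Ω, with unit tangent t and outward unit normal n on ∂Ω, and let f,h : ∂Ω → ℝ be real analytic on ∂Ω. Then there exists d* > 0 such that, with U∖Ω := ⋃_{w∈∂Ω} { w + ε·n(w) : ε ∈ [0,d*) } (an exterior collar neighbourhood of ∂Ω of constant width d*) and U := (U∖Ω) ∪ Ω, there is a vector field B ∈ C¹(U∖cl(Ω);ℝ²) ∩ C(U∖Ω;ℝ²) satisfying div B = 0 and curl B = 0 on U∖cl(Ω), B·t = f and B·n = h on ∂Ω. -/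
open MeasureTheory Filter Topology Set

/-- Planar divergence of a vector field. -/
noncomputable def divg (B : ℝ × ℝ → ℝ × ℝ) (p : ℝ × ℝ) : ℝ :=
  pdx (fun q => (B q).1) p + pdy (fun q => (B q).2) p

/-- Planar (scalar) curl of a vector field. -/
noncomputable def curl2 (B : ℝ × ℝ → ℝ × ℝ) (p : ℝ × ℝ) : ℝ :=
  pdx (fun q => (B q).2) p - pdy (fun q => (B q).1) p

/-- Euclidean dot product on `ℝ × ℝ`. -/
def dot (u v : ℝ × ℝ) : ℝ := u.1 * v.1 + u.2 * v.2

/-- Euclidean norm on `ℝ × ℝ`. -/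
noncomputable def enorm2 (v : ℝ × ℝ) : ℝ := Real.sqrt (v.1 ^ 2 + v.2 ^ 2)

open scoped ContDiff

/-- A real analytic function `ℝ → ℂ` has a holomorphic extension to a disc around each point. -/
theorem AnalyticAt.exists_holomorphic_extension_ball {F : ℝ → ℂ} {s₀ : ℝ}
    (hF : AnalyticAt ℝ F s₀) :
    ∃ r > 0, ∃ P : ℂ → ℂ, DifferentiableOn ℂ P (Metric.ball (s₀ : ℂ) r) ∧
      ∀ x : ℝ, (x : ℂ) ∈ Metric.ball (s₀ : ℂ) r → P x = F x := by
  obtain ⟨p, R, hp⟩ := hF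
  set q : FormalMultilinearSeries ℂ ℂ ℂ := FormalMultilinearSeries.ofScalars ℂ p.coeff with hq
  have hrad : p.radius = q.radius := by
    apply le_antisymm
    · refine ENNReal.le_of_forall_nnreal_lt fun r hr => ?_
      obtain ⟨C, _, hC⟩ := p.norm_mul_pow_le_of_lt_radius hr
      refine q.le_radius_of_bound C fun n => ?_
      rw [hq, FormalMultilinearSeries.ofScalars_norm,
        ← FormalMultilinearSeries.norm_apply_eq_norm_coef]
      exact hC n
    · refine ENNReal.le_of_forall_nnreal_lt fun r hr => ?_
      obtain ⟨C, _, hC⟩ := q.norm_mul_pow_le_of_lt_radius hr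
      refine p.le_radius_of_bound C fun n => ?_
      rw [FormalMultilinearSeries.norm_apply_eq_norm_coef,
        ← FormalMultilinearSeries.ofScalars_norm (E := ℂ)]
      exact hC n
  have hRq : R ≤ q.radius := hrad ▸ hp.r_le
  obtain ⟨r, hr0, hrR⟩ := ENNReal.lt_iff_exists_nnreal_btwn.1 hp.r_pos
  have hr0' : (0 : ℝ) < r := by exact_mod_cast hr0
  refine ⟨r, hr0', fun ζ => q.sum (ζ - s₀), ?_, ?_⟩
  · have hqb := q.hasFPowerSeriesOnBall (lt_of_lt_of_le hp.r_pos hRq)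
    intro ζ hζ
    have hmem : ζ - s₀ ∈ Metric.eball (0 : ℂ) q.radius := by
      refine Metric.eball_subset_eball (hrR.le.trans hRq) ?_
      rw [Metric.eball_coe]
      simpa [dist_eq_norm] using hζ
    have h1 : DifferentiableAt ℂ q.sum (ζ - s₀) := (hqb.analyticAt_of_mem hmem).differentiableAt
    exact (h1.comp ζ (differentiableAt_id.sub_const _)).differentiableWithinAt
  · intro x hx
    have hmem : x - s₀ ∈ Metric.eball (0 : ℝ) R := by
      refine Metric.eball_subset_eball hrR.le ?_
      rw [Metric.eball_coe]
      simpa [dist_eq_norm, ← Complex.ofReal_sub] using hx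
    have hs := hp.hasSum hmem
    rw [add_sub_cancel] at hs
    rw [← hs.tsum_eq]
    refine tsum_congr fun n => ?_
    rw [hq, FormalMultilinearSeries.ofScalars_apply_eq, FormalMultilinearSeries.apply_eq_pow_smul_coeff,
      smul_eq_mul, Complex.real_smul]
    push_cast
    ring

/-- Two holomorphic extensions of the same function on the real line agree on the intersection
of discs centred on the real line. -/
theorem eq_of_holomorphic_extensions {F : ℝ → ℂ} {s₁ s₂ r₁ r₂ : ℝ} {P₁ P₂ : ℂ → ℂ} {ζ : ℂ}
    (h₁ : DifferentiableOn ℂ P₁ (Metric.ball (s₁ : ℂ) r₁))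
    (h₂ : DifferentiableOn ℂ P₂ (Metric.ball (s₂ : ℂ) r₂))
    (e₁ : ∀ x : ℝ, (x : ℂ) ∈ Metric.ball (s₁ : ℂ) r₁ → P₁ x = F x)
    (e₂ : ∀ x : ℝ, (x : ℂ) ∈ Metric.ball (s₂ : ℂ) r₂ → P₂ x = F x)
    (m₁ : ζ ∈ Metric.ball (s₁ : ℂ) r₁) (m₂ : ζ ∈ Metric.ball (s₂ : ℂ) r₂) :
    P₁ ζ = P₂ ζ := by
  set U := Metric.ball (s₁ : ℂ) r₁ ∩ Metric.ball (s₂ : ℂ) r₂ with hU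
  have hUo : IsOpen U := Metric.isOpen_ball.inter Metric.isOpen_ball
  have hre : ∀ (s r : ℝ), ζ ∈ Metric.ball (s : ℂ) r → (ζ.re : ℂ) ∈ Metric.ball (s : ℂ) r := by
    intro s r hm
    rw [Metric.mem_ball, dist_eq_norm] at hm ⊢
    refine lt_of_le_of_lt ?_ hm
    rw [← Complex.ofReal_sub, Complex.norm_real]
    simpa using Complex.abs_re_le_norm (ζ - s)
  have hreU : (ζ.re : ℂ) ∈ U := ⟨hre _ _ m₁, hre _ _ m₂⟩
  have hpre : IsPreconnected U :=
    ((convex_ball _ _).inter (convex_ball _ _)).isPreconnected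
  refine AnalyticOnNhd.eqOn_of_preconnected_of_frequently_eq
    ((h₁.mono inter_subset_left).analyticOnNhd hUo)
    ((h₂.mono inter_subset_right).analyticOnNhd hUo) hpre hreU ?_ ⟨m₁, m₂⟩
  have hcont : ContinuousAt (fun x : ℝ => (x : ℂ)) ζ.re := Complex.continuous_ofReal.continuousAt
  have hev : ∀ᶠ x : ℝ in 𝓝[≠] ζ.re, P₁ (x : ℂ) = P₂ (x : ℂ) := by
    filter_upwards [nhdsWithin_le_nhds (hcont (hUo.mem_nhds hreU))] with x hx
    rw [e₁ x hx.1, e₂ x hx.2]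
  have htend : Tendsto (fun x : ℝ => (x : ℂ)) (𝓝[≠] ζ.re) (𝓝[≠] (ζ.re : ℂ)) :=
    hcont.continuousWithinAt.tendsto_nhdsWithin fun x hx => by simpa using hx
  exact htend.frequently hev.frequently

/-- A periodic real analytic function `ℝ → ℂ` has a periodic holomorphic extension to a strip. -/
theorem exists_periodic_holomorphic_extension {F : ℝ → ℂ} {T : ℝ} (hT : 0 < T)
    (hF : ∀ s, AnalyticAt ℝ F s) (hper : Function.Periodic F T) :
    ∃ d > 0, ∃ E : ℂ → ℂ, (∀ ζ : ℂ, |ζ.im| < d → AnalyticAt ℂ E ζ) ∧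
      Function.Periodic E T ∧ ∀ x : ℝ, E x = F x := by
  classical
  let R : ℂ → ℂ → Prop := fun ζ v => ∃ (s r : ℝ) (P : ℂ → ℂ),
    DifferentiableOn ℂ P (Metric.ball (s : ℂ) r) ∧
    (∀ x : ℝ, (x : ℂ) ∈ Metric.ball (s : ℂ) r → P x = F x) ∧ ζ ∈ Metric.ball (s : ℂ) r ∧ P ζ = v
  have hfun : ∀ ζ v w, R ζ v → R ζ w → v = w := by
    rintro ζ v w ⟨s, r, P, h1, h2, h3, rfl⟩ ⟨s', r', P', h1', h2', h3', rfl⟩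
    exact eq_of_holomorphic_extensions h1 h1' h2 h2' h3 h3'
  have hshift : ∀ (ζ v : ℂ) (c : ℝ), Function.Periodic F c → R ζ v → R (ζ - c) v := by
    rintro ζ v c hc ⟨s, r, P, h1, h2, h3, rfl⟩
    have hm : ∀ ξ : ℂ, ξ ∈ Metric.ball ((s - c : ℝ) : ℂ) r → ξ + c ∈ Metric.ball (s : ℂ) r := by
      intro ξ hξ
      rw [Metric.mem_ball, dist_eq_norm] at hξ ⊢
      convert hξ using 2
      push_cast
      ring
    refine ⟨s - c, r, fun ξ => P (ξ + c), ?_, ?_, ?_, by simp⟩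
    · exact h1.comp (differentiableOn_id.add_const _) hm
    · intro x hx
      have := h2 (x + c) (by simpa using hm _ hx)
      rw [hc x] at this
      simpa using this
    · rw [Metric.mem_ball, dist_eq_norm] at h3 ⊢
      convert h3 using 2
      push_cast
      ring
  have hshift' : ∀ ζ v, R ζ v ↔ R (ζ + T) v := by
    intro ζ v
    constructor
    · intro h
      simpa using hshift ζ v (-T) hper.neg h
    · intro h
      simpa using hshift _ v T hper h
  let E : ℂ → ℂ := fun ζ => if h : ∃ v, R ζ v then h.choose else 0
  have hE : ∀ ζ v, R ζ v → E ζ = v := by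
    intro ζ v h
    have h' : ∃ v, R ζ v := ⟨v, h⟩
    simp only [E, dif_pos h']
    exact hfun ζ _ _ h'.choose_spec h
  have hEper : Function.Periodic E T := by
    intro ζ
    by_cases h : ∃ v, R ζ v
    · obtain ⟨v, hv⟩ := h
      rw [hE _ v hv, hE _ v ((hshift' _ _).1 hv)]
    · have h' : ¬ ∃ v, R (ζ + T) v := fun ⟨v, hv⟩ => h ⟨v, (hshift' _ _).2 hv⟩
      simp only [E, dif_neg h, dif_neg h']
  have hloc : ∀ s : ℝ, AnalyticAt ℂ E s ∧ E s = F s := by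
    intro s
    obtain ⟨r, hr, P, h1, h2⟩ := (hF s).exists_holomorphic_extension_ball
    have hEP : ∀ ζ ∈ Metric.ball (s : ℂ) r, E ζ = P ζ :=
      fun ζ hζ => hE ζ _ ⟨s, r, P, h1, h2, hζ, rfl⟩
    have hball := Metric.isOpen_ball.mem_nhds (Metric.mem_ball_self (x := (s : ℂ)) hr)
    refine ⟨(h1.analyticAt hball).congr ?_, ?_⟩
    · filter_upwards [hball] with ζ hζ
      exact (hEP ζ hζ).symm
    · rw [hEP _ (Metric.mem_ball_self hr), h2 _ (Metric.mem_ball_self hr)]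
  have hK : IsCompact ((fun x : ℝ => (x : ℂ)) '' Icc 0 T) :=
    isCompact_Icc.image Complex.continuous_ofReal
  obtain ⟨d, hd, hsub⟩ := hK.exists_thickening_subset_open (isOpen_analyticAt ℂ E)
    (by rintro _ ⟨x, -, rfl⟩; exact (hloc x).1)
  refine ⟨d, hd, E, ?_, hEper, fun x => (hloc x).2⟩
  intro ζ hζ
  have hn : ∃ n : ℤ, ζ.re - n * T ∈ Ico 0 T :=
    ⟨toIcoDiv hT 0 ζ.re, by simpa using sub_toIcoDiv_zsmul_mem_Ico hT 0 ζ.re⟩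
  obtain ⟨n, hn⟩ := hn
  have h1 : AnalyticAt ℂ E (ζ - n * T) := by
    refine hsub (Metric.mem_thickening_iff.2 ⟨((ζ.re - n * T : ℝ) : ℂ), ⟨_, Ico_subset_Icc_self hn, rfl⟩, ?_⟩)
    rw [dist_eq_norm]
    have : ζ - n * T - ((ζ.re - n * T : ℝ) : ℂ) = (ζ.im : ℂ) * Complex.I := by
      apply Complex.ext <;> simp
    rw [this]
    simpa using hζ
  have h2 : E = E ∘ fun ξ : ℂ => ξ - n * T := by
    funext ξ
    exact (hEper.sub_int_mul_eq n).symm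
  rw [h2]
  exact AnalyticAt.comp h1 (analyticAt_id.sub analyticAt_const)

/-- A map on `ℝ × ℝ`, periodic in the first variable, that is injective modulo the period on
`ℝ × {0}` and locally injective at its points is injective modulo the period on a strip. -/
theorem exists_strip_injective {Y : Type*} [TopologicalSpace Y] [T2Space Y] {T : ℝ} (hT : 0 < T)
    {Φ : ℝ × ℝ → Y} (hper : ∀ s e, Φ (s + T, e) = Φ (s, e))
    (hinj : ∀ s s', Φ (s, 0) = Φ (s', 0) → ∃ n : ℤ, s' = s + n * T)
    (hcont : ∀ s, ContinuousAt Φ (s, 0)) (hloc : ∀ s, ∃ u ∈ 𝓝 ((s, 0) : ℝ × ℝ), InjOn Φ u) :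
    ∃ d > 0, ∀ s s' e e' : ℝ, |e| < d → |e'| < d → Φ (s, e) = Φ (s', e') →
      e = e' ∧ ∃ n : ℤ, s' = s + n * T := by
  have : Fact (0 < T) := ⟨hT⟩
  let q : ℝ × ℝ → AddCircle T × ℝ := Prod.map (fun s : ℝ => (s : AddCircle T)) id
  have hq : IsOpenQuotientMap q :=
    (QuotientAddGroup.isOpenQuotientMap_mk (N := AddSubgroup.zmultiples T)).prodMap
      IsOpenQuotientMap.id
  have hmk : ∀ s s' : ℝ, (s : AddCircle T) = (s' : AddCircle T) ↔ ∃ n : ℤ, s' = s + n * T := by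
    intro s s'
    refine QuotientAddGroup.eq.trans (AddSubgroup.mem_zmultiples_iff.trans (exists_congr fun n => ?_))
    rw [zsmul_eq_mul, eq_comm, neg_add_eq_iff_eq_add]
  let Ψ : AddCircle T × ℝ → Y := fun x =>
    (show Function.Periodic (fun s => Φ (s, x.2)) T from fun s => hper s x.2).lift x.1
  have hΨ : ∀ x, Ψ (q x) = Φ x := fun x => rfl
  have hK : IsCompact ((univ : Set (AddCircle T)) ×ˢ ({0} : Set ℝ)) :=
    isCompact_univ.prod isCompact_singleton
  have hsurj : ∀ x ∈ (univ : Set (AddCircle T)) ×ˢ ({0} : Set ℝ), ∃ s : ℝ, q (s, 0) = x := by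
    rintro ⟨x, e⟩ ⟨-, he⟩
    obtain ⟨s, rfl⟩ := QuotientAddGroup.mk_surjective x
    exact ⟨s, Prod.ext rfl (Eq.symm he)⟩
  obtain ⟨t, ht, hti⟩ := Set.InjOn.exists_mem_nhdsSet (f := Ψ) (s := univ ×ˢ ({0} : Set ℝ))
    (by
      intro x hx y hy hxy
      obtain ⟨s, rfl⟩ := hsurj x hx
      obtain ⟨s', rfl⟩ := hsurj y hy
      rw [hΨ, hΨ] at hxy
      exact Prod.ext ((hmk s s').2 (hinj s s' hxy)) rfl)
    hK
    (by
      intro x hx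
      obtain ⟨s, rfl⟩ := hsurj x hx
      rw [ContinuousAt, ← hq.map_nhds_eq, Filter.tendsto_map'_iff]
      exact hcont s)
    (by
      intro x hx
      obtain ⟨s, rfl⟩ := hsurj x hx
      obtain ⟨u, hu, hui⟩ := hloc s
      refine ⟨q '' u, hq.isOpenMap.image_mem_nhds hu, ?_⟩
      rintro _ ⟨a, ha, rfl⟩ _ ⟨b, hb, rfl⟩ hab
      rw [hΨ, hΨ] at hab
      rw [hui ha hb hab])
  rw [isCompact_univ.nhdsSet_prod_eq isCompact_singleton, nhdsSet_univ, nhdsSet_singleton] at ht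
  obtain ⟨a, ha, b, hb, hab⟩ := Filter.mem_prod_iff.1 ht
  rw [Filter.mem_top] at ha
  subst ha
  obtain ⟨d, hd, hdb⟩ := Metric.mem_nhds_iff.1 hb
  refine ⟨d, hd, fun s s' e e' he he' h => ?_⟩
  have hm : ∀ s e : ℝ, |e| < d → q (s, e) ∈ t := fun s e he =>
    hab ⟨mem_univ _, hdb (show e ∈ Metric.ball (0 : ℝ) d by simpa using he)⟩
  have := hti (hm s e he) (hm s' e' he') h
  exact ⟨congrArg Prod.snd this, (hmk s s').1 (congrArg Prod.fst this)⟩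

/-- A periodic real analytic function along a regular closed real analytic Jordan curve in `ℂ`
is the restriction of a function that is holomorphic near the curve. -/
theorem exists_analyticAt_along_curve {z G : ℝ → ℂ} {T : ℝ} (hT : 0 < T)
    (hz : ∀ s, AnalyticAt ℝ z s) (hzper : Function.Periodic z T) (hz' : ∀ s, deriv z s ≠ 0)
    (hinj : ∀ s s', z s = z s' → ∃ n : ℤ, s' = s + n * T)
    (hG : ∀ s, AnalyticAt ℝ G s) (hGper : Function.Periodic G T) :
    ∃ g : ℂ → ℂ, ∀ s, AnalyticAt ℂ g (z s) ∧ g (z s) = G s := by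
  classical
  obtain ⟨d₁, hd₁, Z, hZ, hZper, hZz⟩ := exists_periodic_holomorphic_extension hT hz hzper
  obtain ⟨d₂, hd₂, E, hE, hEper, hEG⟩ := exists_periodic_holomorphic_extension hT hG hGper
  have hZs : ∀ s : ℝ, AnalyticAt ℂ Z s := fun s => hZ _ (by simpa using hd₁)
  have hZ' : ∀ s : ℝ, deriv Z s ≠ 0 := by
    intro s h0
    have h1 := (hZs s).differentiableAt.hasDerivAt.comp_ofReal
    simp only [hZz] at h1
    exact hz' s (h1.deriv.trans h0)
  let j : ℝ × ℝ → ℂ := fun x => (x.1 : ℂ) + x.2 * Complex.I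
  have hj : Continuous j := by fun_prop
  have hjre : ∀ x, (j x).re = x.1 := fun x => by simp [j]
  have hjim : ∀ x, (j x).im = x.2 := fun x => by simp [j]
  have hj0 : ∀ s, j (s, 0) = s := fun s => by simp [j]
  have hjc : ∀ ζ : ℂ, j (ζ.re, ζ.im) = ζ := fun ζ => Complex.re_add_im ζ
  obtain ⟨d₃, hd₃, hd₃i⟩ := exists_strip_injective (Φ := fun x => Z (j x)) hT
    (by
      intro s e
      rw [← hZper (j (s, e))]
      congr 1
      simp only [j]
      push_cast
      ring)
    (by
      intro s s' h
      simp only [hj0, hZz] at h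
      exact hinj s s' h)
    (by
      intro s
      refine ContinuousAt.comp ?_ hj.continuousAt
      rw [hj0]
      exact (hZs s).continuousAt)
    (by
      intro s
      have hst := (hZs s).hasStrictDerivAt.hasStrictFDerivAt_equiv (hZ' s)
      let φ := hst.toOpenPartialHomeomorph Z
      refine ⟨j ⁻¹' φ.source, hj.continuousAt.preimage_mem_nhds ?_, ?_⟩
      · rw [hj0]
        exact φ.open_source.mem_nhds hst.mem_toOpenPartialHomeomorph_source
      · intro x hx y hy hxy
        have := φ.injOn hx hy hxy
        exact Prod.ext (by rw [← hjre, this, hjre]) (by rw [← hjim, this, hjim]))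
  let S : Set ℂ := {ζ | |ζ.im| < min d₂ d₃}
  have hSo : IsOpen S := isOpen_lt (by fun_prop) continuous_const
  have hSs : ∀ s : ℝ, (s : ℂ) ∈ S := fun s => by simpa [S] using ⟨hd₂, hd₃⟩
  have hEZ : ∀ ζ ∈ S, ∀ ξ ∈ S, Z ζ = Z ξ → E ζ = E ξ := by
    intro ζ hζ ξ hξ h
    obtain ⟨h1, n, h2⟩ := hd₃i ζ.re ξ.re ζ.im ξ.im (hζ.trans_le (min_le_right _ _))
      (hξ.trans_le (min_le_right _ _)) (by simpa only [hjc] using h)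
    have : ξ = ζ + n * T := by
      apply Complex.ext
      · simpa using h2
      · simpa using h1.symm
    rw [this]
    exact (hEper.int_mul n ζ).symm
  let g : ℂ → ℂ := fun p => if h : ∃ ζ ∈ S, Z ζ = p then E h.choose else 0
  have hg : ∀ ζ ∈ S, g (Z ζ) = E ζ := by
    intro ζ hζ
    have h : ∃ ξ ∈ S, Z ξ = Z ζ := ⟨ζ, hζ, rfl⟩
    simp only [g, dif_pos h]
    exact hEZ _ h.choose_spec.1 _ hζ h.choose_spec.2
  refine ⟨g, fun s => ⟨?_, ?_⟩⟩
  · have hc : ContDiffAt ℂ ω Z s := (hZs s).contDiffAt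
    have hst := (hZs s).hasStrictDerivAt.hasStrictFDerivAt_equiv (hZ' s)
    have hinv := hc.to_localInverse hst.hasFDerivAt (by simp)
    have hψ : AnalyticAt ℂ (hst.localInverse Z _ _) (Z s) := hinv.analyticAt
    have hψs : hst.localInverse Z _ _ (Z s) = s := hst.localInverse_apply_image
    rw [← hZz]
    have hcomp : AnalyticAt ℂ (fun p => E (hst.localInverse Z _ _ p)) (Z s) := by
      refine AnalyticAt.comp ?_ hψ
      rw [hψs]
      exact hE _ (by simpa using hd₂)
    refine hcomp.congr ?_
    have hev : ∀ᶠ p in 𝓝 (Z s), hst.localInverse Z _ _ p ∈ S :=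
      hst.localInverse_tendsto (hSo.mem_nhds (hSs s))
    filter_upwards [hst.eventually_right_inverse, hev] with p hp hpS
    rw [← hg _ hpS, hp]
  · rw [← hZz, hg _ (hSs s), hEG]

/-- The vector field of components `(re g, -im g)` for `g : ℂ → ℂ`. -/
noncomputable def conjField (g : ℂ → ℂ) (p : ℝ × ℝ) : ℝ × ℝ :=
  ((g (p.1 + p.2 * Complex.I)).re, -(g (p.1 + p.2 * Complex.I)).im)

theorem contDiffAt_conjField {g : ℂ → ℂ} {p : ℝ × ℝ}
    (hg : AnalyticAt ℂ g (p.1 + p.2 * Complex.I)) : ContDiffAt ℝ 1 (conjField g) p := by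
  have h1 : ContDiffAt ℝ 1 g (p.1 + p.2 * Complex.I) := (hg.contDiffAt (n := 1)).restrict_scalars ℝ
  have hj : ContDiff ℝ 1 (fun p : ℝ × ℝ => (p.1 : ℂ) + p.2 * Complex.I) :=
    (Complex.ofRealCLM.contDiff.comp contDiff_fst).add
      ((Complex.ofRealCLM.contDiff.comp contDiff_snd).mul contDiff_const)
  have h2 : ContDiffAt ℝ 1 (fun p : ℝ × ℝ => g (p.1 + p.2 * Complex.I)) p :=
    ContDiffAt.comp p h1 hj.contDiffAt
  exact (Complex.reCLM.contDiff.contDiffAt.comp p h2).prodMk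
    (Complex.imCLM.contDiff.contDiffAt.comp p h2).neg

theorem divg_curl2_conjField {g : ℂ → ℂ} {p : ℝ × ℝ}
    (hg : AnalyticAt ℂ g (p.1 + p.2 * Complex.I)) :
    divg (conjField g) p = 0 ∧ curl2 (conjField g) p = 0 := by
  obtain ⟨w, hw⟩ : ∃ w, HasDerivAt g w (p.1 + p.2 * Complex.I) :=
    ⟨_, hg.differentiableAt.hasDerivAt⟩
  have hx : HasDerivAt (fun x : ℝ => g (x + p.2 * Complex.I)) w p.1 := by
    have h : HasDerivAt (fun x : ℝ => (x : ℂ) + p.2 * Complex.I) 1 p.1 :=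
      Complex.ofRealCLM.hasDerivAt.add_const _
    simpa [Function.comp_def] using hw.scomp p.1 h
  have hy : HasDerivAt (fun y : ℝ => g (p.1 + y * Complex.I)) (Complex.I * w) p.2 := by
    have h : HasDerivAt (fun y : ℝ => (p.1 : ℂ) + y * Complex.I) (1 * Complex.I) p.2 :=
      ((Complex.ofRealCLM.hasDerivAt (x := p.2)).mul_const Complex.I).const_add _
    simpa [Function.comp_def] using hw.scomp p.2 h
  have hx1 : HasDerivAt (fun x : ℝ => (g (x + p.2 * Complex.I)).re) w.re p.1 :=
    Complex.reCLM.hasFDerivAt.comp_hasDerivAt p.1 hx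
  have hx2 : HasDerivAt (fun x : ℝ => -(g (x + p.2 * Complex.I)).im) (-w.im) p.1 :=
    (Complex.imCLM.hasFDerivAt.comp_hasDerivAt p.1 hx).neg
  have hy1 : HasDerivAt (fun y : ℝ => (g (p.1 + y * Complex.I)).re) (Complex.I * w).re p.2 :=
    Complex.reCLM.hasFDerivAt.comp_hasDerivAt p.2 hy
  have hy2 : HasDerivAt (fun y : ℝ => -(g (p.1 + y * Complex.I)).im) (-(Complex.I * w).im) p.2 :=
    (Complex.imCLM.hasFDerivAt.comp_hasDerivAt p.2 hy).neg
  constructor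
  · simp only [divg, pdx, pdy, conjField]
    rw [hx1.deriv, hy2.deriv]
    simp
  · simp only [curl2, pdx, pdy, conjField]
    rw [hx2.deriv, hy1.deriv]
    simp

theorem dot_self_pos {v : ℝ × ℝ} (hv : v ≠ 0) : 0 < dot v v := by
  rcases v with ⟨a, b⟩
  have h : a ≠ 0 ∨ b ≠ 0 := by
    by_contra! h
    exact hv (Prod.ext h.1 h.2)
  simp only [dot]
  rcases h with h | h <;> nlinarith [mul_self_pos.2 h, mul_self_nonneg a, mul_self_nonneg b]

/-- The normal map `(s, e) ↦ γ s + e • N s` has an invertible derivative on `ℝ × {0}`. -/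
theorem exists_hasStrictFDerivAt_normal {γ N : ℝ → ℝ × ℝ} {s : ℝ} (hγ : ContDiffAt ℝ 1 γ s)
    (hN : ContDiffAt ℝ 1 N s) (hγ' : deriv γ s ≠ 0) (hN0 : N s ≠ 0)
    (horth : dot (N s) (deriv γ s) = 0) :
    ∃ L : (ℝ × ℝ) ≃L[ℝ] (ℝ × ℝ), HasStrictFDerivAt (fun x : ℝ × ℝ => γ x.1 + x.2 • N x.1)
      (L : (ℝ × ℝ) →L[ℝ] (ℝ × ℝ)) (s, 0) := by
  have h1 : HasStrictFDerivAt γ (fderiv ℝ γ s) ((s, 0) : ℝ × ℝ).1 :=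
    hγ.hasStrictFDerivAt one_ne_zero
  have h2 : HasStrictFDerivAt N (fderiv ℝ N s) ((s, 0) : ℝ × ℝ).1 :=
    hN.hasStrictFDerivAt one_ne_zero
  have h := (h1.comp (s, (0 : ℝ)) hasStrictFDerivAt_fst).add
    ((hasStrictFDerivAt_snd (p := (s, (0 : ℝ)))).smul
      (h2.comp (s, (0 : ℝ)) hasStrictFDerivAt_fst))
  obtain ⟨A, hA, hAv⟩ : ∃ A : (ℝ × ℝ) →L[ℝ] (ℝ × ℝ),
      HasStrictFDerivAt (fun x : ℝ × ℝ => γ x.1 + x.2 • N x.1) A (s, 0) ∧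
      ∀ v, A v = v.1 • deriv γ s + v.2 • N s := by
    refine ⟨_, h, fun v => ?_⟩
    simp
  have hinj : Function.Injective A := by
    rw [injective_iff_map_eq_zero]
    intro v hv
    rw [hAv] at hv
    have e1 := congrArg Prod.fst hv
    have e2 := congrArg Prod.snd hv
    simp only [Prod.fst_add, Prod.snd_add, Prod.smul_fst, Prod.smul_snd, smul_eq_mul,
      Prod.fst_zero, Prod.snd_zero] at e1 e2
    have p1 := dot_self_pos hγ'
    have p2 := dot_self_pos hN0
    simp only [dot] at p1 p2 horth
    have q1 : v.1 * ((deriv γ s).1 * (deriv γ s).1 + (deriv γ s).2 * (deriv γ s).2) = 0 := by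
      linear_combination (deriv γ s).1 * e1 + (deriv γ s).2 * e2 - v.2 * horth
    have q2 : v.2 * ((N s).1 * (N s).1 + (N s).2 * (N s).2) = 0 := by
      linear_combination (N s).1 * e1 + (N s).2 * e2 - v.1 * horth
    exact Prod.ext ((mul_eq_zero.1 q1).resolve_right p1.ne')
      ((mul_eq_zero.1 q2).resolve_right p2.ne')
  refine ⟨ContinuousLinearEquiv.ofBijective A (LinearMap.ker_eq_bot.2 hinj)
    (LinearMap.range_eq_top.2 (LinearMap.surjective_of_injective (f := (A : (ℝ × ℝ) →ₗ[ℝ] _)) hinj)), ?_⟩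
  rwa [ContinuousLinearEquiv.coe_ofBijective]

/-- Along a regular closed curve bounding an open set, a unit normal field pointing out of the set
is globally `N` or globally `-N`, and its short normal segments form an exterior collar. -/
theorem exists_exterior_collar {Ω : Set (ℝ × ℝ)} (hΩo : IsOpen Ω) {γ N nor' : ℝ → ℝ × ℝ} {T : ℝ}
    (hT : 0 < T) (hγ : ContDiff ℝ 1 γ) (hγper : Function.Periodic γ T)
    (hγ' : ∀ s, deriv γ s ≠ 0) (hrange : Set.range γ = frontier Ω)
    (hinj : ∀ s s', γ s = γ s' → ∃ n : ℤ, s' = s + n * T)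
    (hN : ContDiff ℝ 1 N) (hNper : Function.Periodic N T) (hN0 : ∀ s, N s ≠ 0)
    (horth : ∀ s, dot (N s) (deriv γ s) = 0)
    (hsign : ∀ s, nor' s = N s ∨ nor' s = -N s)
    (hout : ∀ s, ∃ ε > (0 : ℝ), ∀ δ ∈ Ioo 0 ε, γ s + δ • nor' s ∉ closure Ω) :
    ((∀ s, nor' s = N s) ∨ ∀ s, nor' s = -N s) ∧ ∃ d > 0,
      (∀ s s' e e' : ℝ, |e| < d → |e'| < d → γ s + e • nor' s = γ s' + e' • nor' s' →
        γ s = γ s') ∧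
      ∀ s, ∀ e ∈ Ioo 0 d, γ s + e • nor' s ∉ closure Ω := by
  set Φ : ℝ × ℝ → ℝ × ℝ := fun x => γ x.1 + x.2 • N x.1 with hΦ
  have hΦc : Continuous Φ := by
    have := hγ.continuous
    have := hN.continuous
    fun_prop
  have hder := fun s => exists_hasStrictFDerivAt_normal hγ.contDiffAt hN.contDiffAt (hγ' s)
    (hN0 s) (horth s)
  have hΦ0 : ∀ s, Φ (s, 0) = γ s := fun s => by simp [hΦ]
  obtain ⟨d, hd, hstrip⟩ := exists_strip_injective (Φ := Φ) hT
    (fun s e => by simp only [hΦ]; rw [hγper, hNper])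
    (fun s s' h => hinj s s' (by rwa [hΦ0, hΦ0] at h))
    (fun s => hΦc.continuousAt)
    (fun s => by
      obtain ⟨L, hL⟩ := hder s
      exact ⟨_, (hL.toOpenPartialHomeomorph Φ).open_source.mem_nhds
        hL.mem_toOpenPartialHomeomorph_source, (hL.toOpenPartialHomeomorph Φ).injOn⟩)
  have hside : ∀ σ : ℝ, |σ| = 1 → (∃ s, nor' s = σ • N s) →
      ∀ s, ∀ e ∈ Ioo 0 d, Φ (s, σ * e) ∉ closure Ω := by
    intro σ hσ ⟨s₀, hs₀⟩ s e he
    set A : Set (ℝ × ℝ) := (fun x : ℝ × ℝ => Φ (x.1, σ * x.2)) '' (univ ×ˢ Ioo 0 d) with hA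
    have hApre : IsPreconnected A :=
      (isPreconnected_univ.prod isPreconnected_Ioo).image _ (by fun_prop)
    have hAfr : A ∩ frontier Ω = ∅ := by
      rw [eq_empty_iff_forall_notMem]
      rintro _ ⟨⟨⟨t, ε⟩, ⟨-, hε⟩, rfl⟩, hfr⟩
      rw [← hrange] at hfr
      obtain ⟨t', ht'⟩ := hfr
      rw [← hΦ0] at ht'
      have hε' : |σ * ε| < d := by
        rw [abs_mul, hσ, one_mul, abs_of_pos hε.1]
        exact hε.2
      have h0 := (hstrip t' t 0 (σ * ε) (by simpa using hd) hε' ht').1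
      have : |σ * ε| = 0 := by rw [← h0, abs_zero]
      rw [abs_mul, hσ, one_mul, abs_of_pos hε.1] at this
      exact hε.1.ne' this
    intro hmem
    obtain ⟨ε, hε, hεo⟩ := hout s₀
    obtain ⟨δ, hδ0, hδ⟩ := exists_between (lt_min hε hd)
    have hq : Φ (s₀, σ * δ) ∈ A := ⟨(s₀, δ), ⟨mem_univ _, hδ0, hδ.trans_le (min_le_right _ _)⟩, rfl⟩
    have hqc : Φ (s₀, σ * δ) ∉ closure Ω := by
      have := hεo δ ⟨hδ0, hδ.trans_le (min_le_left _ _)⟩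
      rwa [hs₀, smul_smul, mul_comm] at this
    have hp : Φ (s, σ * e) ∈ A := ⟨(s, e), ⟨mem_univ _, he⟩, rfl⟩
    have hcover : A ⊆ Ω ∪ (closure Ω)ᶜ := by
      intro x hx
      by_contra hn
      simp only [mem_union, mem_compl_iff, not_or, not_not] at hn
      have : x ∈ A ∩ frontier Ω := ⟨hx, hΩo.frontier_eq ▸ ⟨hn.2, hn.1⟩⟩
      rw [hAfr] at this
      exact this
    have hpΩ : Φ (s, σ * e) ∈ Ω := (hcover hp).resolve_right fun h => h hmem
    obtain ⟨x, -, hxΩ, hx⟩ := hApre Ω (closure Ω)ᶜ hΩo isClosed_closure.isOpen_compl hcover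
      ⟨_, hp, hpΩ⟩ ⟨_, hq, hqc⟩
    exact hx (subset_closure hxΩ)
  have hnot : ¬ ((∃ s, nor' s = N s) ∧ ∃ s, nor' s = -N s) := by
    rintro ⟨h1, h2⟩
    have c1 := hside 1 (by simp) (by simpa using h1)
    have c2 := hside (-1) (by simp) (by simpa using h2)
    obtain ⟨L, hL⟩ := hder 0
    have hmap : map Φ (𝓝 (0, 0)) = 𝓝 (γ 0) := by
      rw [← hΦ0]
      exact hL.map_nhds_eq_of_equiv
    have hev : ∀ᶠ p in 𝓝 (γ 0), p ∉ Ω := by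
      rw [← hmap, eventually_map]
      have hnear : ∀ᶠ x : ℝ × ℝ in 𝓝 (0, 0), |x.2| < d :=
        (isOpen_lt (by fun_prop) continuous_const).mem_nhds (by simpa using hd)
      filter_upwards [hnear] with ⟨s, e⟩ he hmem
      rcases lt_trichotomy e 0 with h | h | h
      · refine c2 s (-e) ⟨by linarith, (neg_le_abs e).trans_lt he⟩ (subset_closure ?_)
        simpa using hmem
      · subst h
        rw [hΦ0] at hmem
        have hfr : γ s ∈ frontier Ω := hrange ▸ mem_range_self s
        rw [hΩo.frontier_eq] at hfr
        exact hfr.2 hmem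
      · refine c1 s e ⟨h, (le_abs_self e).trans_lt he⟩ (subset_closure ?_)
        simpa using hmem
    have hcl : γ 0 ∈ closure Ω := frontier_subset_closure (hrange ▸ mem_range_self 0)
    exact (mem_closure_iff_frequently.1 hcl) hev
  have key : ∃ σ : ℝ, |σ| = 1 ∧ (σ = 1 ∨ σ = -1) ∧ ∀ s, nor' s = σ • N s := by
    by_cases h1 : ∃ s, nor' s = -N s
    · exact ⟨-1, by simp, Or.inr rfl, fun s => by
        simpa using (hsign s).resolve_left fun h => hnot ⟨⟨s, h⟩, h1⟩⟩
    · exact ⟨1, by simp, Or.inl rfl, fun s => by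
        simpa using (hsign s).resolve_right fun h => h1 ⟨s, h⟩⟩
  obtain ⟨σ, hσ, hσ', hnσ⟩ := key
  have hnΦ : ∀ s e, γ s + e • nor' s = Φ (s, σ * e) := fun s e => by
    rw [hnσ, smul_smul, mul_comm]
  refine ⟨?_, d, hd, ?_, ?_⟩
  · rcases hσ' with rfl | rfl
    · exact Or.inl fun s => by simpa using hnσ s
    · exact Or.inr fun s => by simpa using hnσ s
  · intro s s' e e' he he' h
    rw [hnΦ, hnΦ] at h
    obtain ⟨-, n, hn⟩ := hstrip s s' (σ * e) (σ * e') (by rwa [abs_mul, hσ, one_mul])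
      (by rwa [abs_mul, hσ, one_mul]) h
    rw [hn]
    exact (hγper.int_mul n s).symm
  · intro s e he
    rw [hnΦ]
    exact hside σ hσ ⟨0, hnσ 0⟩ s e he

theorem enorm2_sq (v : ℝ × ℝ) : enorm2 v ^ 2 = dot v v := by
  rw [enorm2, Real.sq_sqrt (by positivity), dot]
  ring

theorem enorm2_ne_zero {v : ℝ × ℝ} (hv : v ≠ 0) : enorm2 v ≠ 0 := by
  have h1 := enorm2_sq v
  have h2 := dot_self_pos hv
  intro h
  rw [h] at h1
  norm_num at h1
  exact h2.ne h1

theorem norm_le_enorm2 (v : ℝ × ℝ) : ‖v‖ ≤ enorm2 v := by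
  refine max_le ?_ ?_ <;> refine Real.le_sqrt_of_sq_le ?_ <;> rw [Real.norm_eq_abs, sq_abs]
  · nlinarith [sq_nonneg v.2]
  · nlinarith [sq_nonneg v.1]

/-- The normalised derivative of a regular real analytic plane curve is real analytic. -/
theorem contDiff_unit_tangent {γ : ℝ → ℝ × ℝ} (hγ : ContDiff ℝ ω γ) (hγ' : ∀ s, deriv γ s ≠ 0) :
    ContDiff ℝ ω (fun s => (enorm2 (deriv γ s))⁻¹ • deriv γ s) := by
  have h1 : ContDiff ℝ ω (deriv γ) := ContDiff.deriv' (n := ω) hγ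
  have h2 : ContDiff ℝ ω (fun s => (deriv γ s).1 ^ 2 + (deriv γ s).2 ^ 2) :=
    ((contDiff_fst.comp h1).pow 2).add ((contDiff_snd.comp h1).pow 2)
  have h3 : ContDiff ℝ ω (fun s => enorm2 (deriv γ s)) := by
    refine h2.sqrt fun s => ?_
    have := dot_self_pos (hγ' s)
    rw [dot] at this
    nlinarith
  exact (h3.inv fun s => enorm2_ne_zero (hγ' s)).smul h1

/-- A unit vector orthogonal to the unit vector `t` is one of the two rotations of `t`. -/
theorem eq_or_eq_neg_rotation {n t : ℝ × ℝ} (hn : dot n n = 1) (ht : dot t t = 1)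
    (h : dot n t = 0) : n = (-t.2, t.1) ∨ n = -(-t.2, t.1) := by
  simp only [dot] at hn ht h
  have e1 : n.1 = -(n.2 * t.1 - n.1 * t.2) * t.2 := by
    linear_combination t.1 * h - n.1 * ht
  have e2 : n.2 = (n.2 * t.1 - n.1 * t.2) * t.1 := by
    linear_combination t.2 * h - n.2 * ht
  have e3 : (n.2 * t.1 - n.1 * t.2) ^ 2 = 1 := by
    linear_combination (t.1 * t.1 + t.2 * t.2) * hn + ht - (n.1 * t.1 + n.2 * t.2) * h
  rcases (sq_eq_sq_iff_eq_or_eq_neg.1 (e3.trans (one_pow 2).symm)) with h1 | h1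
  · rw [h1] at e1 e2
    exact Or.inl (Prod.ext (by simpa using e1) (by simpa using e2))
  · rw [h1] at e1 e2
    exact Or.inr (Prod.ext (by simpa using e1) (by simpa using e2))

/-- solvability of the Cauchy problem on an exterior collar neighbourhood of
constant width. Let `Ω ⊂ ℝ²` be open, bounded and simply connected with real analytic boundary
`∂Ω` (regularly parameterised by the `2π`-periodic real analytic `γ`), with unit tangent field
`tau` and outward unit normal field `nor`, and let `f, h` be real analytic on `∂Ω`. Then there is
`d* > 0` such that, with `U∖Ω` the exterior collar `⋃_{w∈∂Ω} {w + ε nor(w) : ε ∈ [0,d*)}` (whose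
fibres are pairwise disjoint) and `U = (U∖Ω) ∪ Ω`, the Cauchy problem `div B = 0`, `curl B = 0`
on `U ∖ cl Ω`, `B·t = f`, `B·n = h` on `∂Ω` has a solution `B ∈ C¹(U∖cl Ω) ∩ C(U∖Ω)`. -/
theorem stmt19
    (Ω : Set (ℝ × ℝ)) (hΩo : IsOpen Ω) (hΩb : Bornology.IsBounded Ω)
    (hΩsc : SimplyConnectedSpace Ω)
    (γ : ℝ → ℝ × ℝ)
    (hγan : AnalyticOnNhd ℝ γ Set.univ)
    (hγper : Function.Periodic γ (2 * Real.pi))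
    (hγreg : ∀ s : ℝ, deriv γ s ≠ 0)
    (hγrange : Set.range γ = frontier Ω)
    (hγinj : Set.InjOn γ (Set.Ico 0 (2 * Real.pi)))
    (tau nor : ℝ × ℝ → ℝ × ℝ)
    -- tau is the unit tangent to ∂Ω
    (htau : ∀ s : ℝ, tau (γ s) = (enorm2 (deriv γ s))⁻¹ • deriv γ s)
    -- nor is the outward unit normal to ∂Ω
    (hnor1 : ∀ v ∈ frontier Ω, enorm2 (nor v) = 1)
    (hnor2 : ∀ v ∈ frontier Ω, dot (nor v) (tau v) = 0)
    (hnor3 : ∀ v ∈ frontier Ω, ∃ ε > (0 : ℝ), ∀ δ ∈ Set.Ioo (0 : ℝ) ε,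
      v + δ • nor v ∉ closure Ω)
    (f h : ℝ × ℝ → ℝ)
    -- f and h are real analytic on ∂Ω
    (hf : AnalyticOnNhd ℝ (fun s : ℝ => f (γ s)) Set.univ)
    (hh : AnalyticOnNhd ℝ (fun s : ℝ => h (γ s)) Set.univ) :
    ∃ d : ℝ, 0 < d ∧ ∃ C U : Set (ℝ × ℝ),
      -- C is the exterior collar neighbourhood of constant width d
      C = {p : ℝ × ℝ | ∃ w ∈ frontier Ω, ∃ ε ∈ Set.Ico (0 : ℝ) d, p = w + ε • nor w} ∧
      U = C ∪ Ω ∧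
      -- the fibres of the collar are pairwise disjoint
      (∀ w₁ ∈ frontier Ω, ∀ w₂ ∈ frontier Ω, w₁ ≠ w₂ →
        Disjoint {p : ℝ × ℝ | ∃ ε ∈ Set.Ico (0 : ℝ) d, p = w₁ + ε • nor w₁}
          {p : ℝ × ℝ | ∃ ε ∈ Set.Ico (0 : ℝ) d, p = w₂ + ε • nor w₂}) ∧
      -- the collar is exterior: U ∖ Ω = C
      U \ Ω = C ∧
      -- and the Cauchy problem has a solution B on it
      ∃ B : ℝ × ℝ → ℝ × ℝ,
        ContDiffOn ℝ 1 B (U \ closure Ω) ∧ ContinuousOn B (U \ Ω) ∧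
        (∀ p ∈ U \ closure Ω, divg B p = 0) ∧
        (∀ p ∈ U \ closure Ω, curl2 B p = 0) ∧
        (∀ v ∈ frontier Ω, dot (B v) (tau v) = f v) ∧
        (∀ v ∈ frontier Ω, dot (B v) (nor v) = h v) := by
  have hT : 0 < 2 * Real.pi := Real.two_pi_pos
  have hγω : ContDiff ℝ ω γ := contDiff_omega_iff_analyticOnNhd.2 hγan
  have hγ1 : ContDiff ℝ 1 γ := hγω.of_le (by simp)
  have hinj : ∀ s s', γ s = γ s' → ∃ n : ℤ, s' = s + n * (2 * Real.pi) := by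
    intro s s' h
    have hm := fun x => toIcoMod_mem_Ico' hT x
    have hγm : ∀ x, γ (toIcoMod hT 0 x) = γ x := fun x => hγper.sub_zsmul_eq _
    have h1 : toIcoMod hT 0 s = toIcoMod hT 0 s' :=
      hγinj (hm s) (hm s') (by rw [hγm, hγm, h])
    refine ⟨toIcoDiv hT 0 s' - toIcoDiv hT 0 s, ?_⟩
    have a1 := toIcoMod_add_toIcoDiv_zsmul hT 0 s
    have a2 := toIcoMod_add_toIcoDiv_zsmul hT 0 s'
    rw [zsmul_eq_mul] at a1 a2
    push_cast
    linear_combination a1 - a2 - h1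
  have hfr : ∀ s, γ s ∈ frontier Ω := fun s => hγrange ▸ mem_range_self s
  have hfr' : ∀ v ∈ frontier Ω, ∃ s, γ s = v := fun v hv => by rwa [← hγrange] at hv
  have htω : ContDiff ℝ ω (fun s => tau (γ s)) := by
    simp only [htau]
    exact contDiff_unit_tangent hγω hγreg
  have htt : ∀ s, dot (tau (γ s)) (tau (γ s)) = 1 := by
    intro s
    have h0 := enorm2_ne_zero (hγreg s)
    have h1 := enorm2_sq (deriv γ s)
    rw [htau]
    simp only [dot, Prod.smul_fst, Prod.smul_snd, smul_eq_mul] at h1 ⊢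
    field_simp
    linear_combination -h1
  have hnn : ∀ v ∈ frontier Ω, dot (nor v) (nor v) = 1 := fun v hv => by
    rw [← enorm2_sq, hnor1 v hv, one_pow]
  set N : ℝ → ℝ × ℝ := fun s => (-(tau (γ s)).2, (tau (γ s)).1) with hN
  have hNω : ContDiff ℝ ω N := (contDiff_snd.comp htω).neg.prodMk (contDiff_fst.comp htω)
  have hNN : ∀ s, dot (N s) (N s) = 1 := fun s => by
    rw [← htt s]
    simp only [dot, hN]
    ring
  have hNorth : ∀ s, dot (N s) (deriv γ s) = 0 := by
    intro s
    simp only [dot, hN, htau, Prod.smul_fst, Prod.smul_snd, smul_eq_mul]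
    ring
  obtain ⟨hsign, d₀, hd₀, hdisj, hext⟩ := exists_exterior_collar hΩo hT hγ1 hγper hγreg hγrange
    hinj (N := N) (nor' := fun s => nor (γ s)) (hNω.of_le (by simp))
    (fun s => by simp only [hN]; rw [hγper])
    (fun s h0 => by
      have := hNN s
      rw [h0] at this
      simp [dot] at this)
    hNorth
    (fun s => eq_or_eq_neg_rotation (hnn _ (hfr s)) (htt s) (hnor2 _ (hfr s)))
    (fun s => hnor3 _ (hfr s))
  have hnω : ContDiff ℝ ω (fun s => nor (γ s)) := by
    rcases hsign with h | h
    · simpa only [h] using hNω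
    · simpa only [h] using hNω.neg
  set b : ℝ × ℝ → ℝ × ℝ := fun v => f v • tau v + h v • nor v with hb
  have hbω : ContDiff ℝ ω (fun s => b (γ s)) :=
    ((contDiff_omega_iff_analyticOnNhd.2 hf).smul htω).add
      ((contDiff_omega_iff_analyticOnNhd.2 hh).smul hnω)
  have hcplx : ∀ {u v : ℝ → ℝ}, ContDiff ℝ ω u → ContDiff ℝ ω v →
      ∀ s, AnalyticAt ℝ (fun s => (u s : ℂ) + v s * Complex.I) s := fun hu hv s =>
    contDiff_omega_iff_analyticOnNhd.1 ((Complex.ofRealCLM.contDiff.comp hu).add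
      ((Complex.ofRealCLM.contDiff.comp hv).mul contDiff_const)) s (mem_univ s)
  set z : ℝ → ℂ := fun s => ((γ s).1 : ℂ) + (γ s).2 * Complex.I with hz
  have hz' : ∀ s, deriv z s ≠ 0 := by
    intro s h0
    have h1 : HasDerivAt γ (deriv γ s) s :=
      (hγ1.differentiable one_ne_zero s).hasDerivAt
    have hfst : HasDerivAt (fun s => (γ s).1) (deriv γ s).1 s :=
      (ContinuousLinearMap.fst ℝ ℝ ℝ).hasFDerivAt.comp_hasDerivAt s h1
    have hsnd : HasDerivAt (fun s => (γ s).2) (deriv γ s).2 s :=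
      (ContinuousLinearMap.snd ℝ ℝ ℝ).hasFDerivAt.comp_hasDerivAt s h1
    have h2 : HasDerivAt z (((deriv γ s).1 : ℂ) + (deriv γ s).2 * Complex.I) s :=
      hfst.ofReal_comp.add (hsnd.ofReal_comp.mul_const _)
    rw [h2.deriv] at h0
    exact hγreg s (Prod.ext (by simpa using congrArg Complex.re h0)
      (by simpa using congrArg Complex.im h0))
  obtain ⟨g, hg⟩ := exists_analyticAt_along_curve hT (z := z)
    (G := fun s => ((b (γ s)).1 : ℂ) + ((-(b (γ s)).2 : ℝ) : ℂ) * Complex.I)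
    (hcplx (contDiff_fst.comp hγω) (contDiff_snd.comp hγω))
    (fun s => by simp only [hz]; rw [hγper]) hz'
    (fun s s' e => hinj s s' (Prod.ext (by simpa [hz] using congrArg Complex.re e)
      (by simpa [hz] using congrArg Complex.im e)))
    (hcplx (contDiff_fst.comp hbω) (contDiff_snd.comp hbω).neg)
    (fun s => by simp only; rw [hγper])
  have hBγ : ∀ v ∈ frontier Ω, conjField g v = b v := by
    intro v hv
    obtain ⟨s, rfl⟩ := hfr' v hv
    have := (hg s).2
    simp only [hz] at this
    rw [conjField, this]
    simp
  have hVo : IsOpen {p : ℝ × ℝ | AnalyticAt ℂ g (p.1 + p.2 * Complex.I)} :=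
    (isOpen_analyticAt ℂ g).preimage (by fun_prop)
  have hcpt : IsCompact (frontier Ω) :=
    hΩb.isCompact_closure.of_isClosed_subset isClosed_frontier frontier_subset_closure
  obtain ⟨d₁, hd₁, hthick⟩ := hcpt.exists_thickening_subset_open hVo (by
    intro v hv
    obtain ⟨s, rfl⟩ := hfr' v hv
    exact (hg s).1)
  set d := min d₀ d₁ with hd
  set C : Set (ℝ × ℝ) :=
    {p | ∃ w ∈ frontier Ω, ∃ ε ∈ Ico (0 : ℝ) d, p = w + ε • nor w} with hC
  have hCan : ∀ p ∈ C, AnalyticAt ℂ g (p.1 + p.2 * Complex.I) := by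
    rintro p ⟨w, hw, ε, hε, rfl⟩
    refine hthick (Metric.mem_thickening_iff.2 ⟨w, hw, ?_⟩)
    rw [dist_eq_norm, add_sub_cancel_left, norm_smul, Real.norm_eq_abs, abs_of_nonneg hε.1]
    have := (norm_le_enorm2 (nor w)).trans_eq (hnor1 w hw)
    have h1 := hε.2.trans_le (min_le_right d₀ d₁)
    nlinarith [hε.1]
  have hCΩ : Disjoint C Ω := by
    rw [Set.disjoint_left]
    rintro p ⟨w, hw, ε, hε, rfl⟩ hp
    rcases hε.1.eq_or_lt with h0 | h0
    · rw [← h0, zero_smul, add_zero] at hp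
      rw [hΩo.frontier_eq] at hw
      exact hw.2 hp
    · obtain ⟨s, rfl⟩ := hfr' w hw
      exact hext s ε ⟨h0, hε.2.trans_le (min_le_left _ _)⟩ (subset_closure hp)
  have hUC : (C ∪ Ω) \ Ω = C := by
    rw [union_sdiff_right, hCΩ.sdiff_eq_left]
  have hUC' : (C ∪ Ω) \ closure Ω ⊆ C := fun p hp =>
    hUC.subset ⟨hp.1, fun hΩ => hp.2 (subset_closure hΩ)⟩
  refine ⟨d, lt_min hd₀ hd₁, C, C ∪ Ω, rfl, rfl, ?_, hUC, conjField g, ?_, ?_, ?_, ?_, ?_, ?_⟩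
  · intro w₁ hw₁ w₂ hw₂ hne
    rw [Set.disjoint_left]
    rintro p ⟨ε, hε, rfl⟩ ⟨ε', hε', he⟩
    obtain ⟨s, rfl⟩ := hfr' w₁ hw₁
    obtain ⟨s', rfl⟩ := hfr' w₂ hw₂
    have habs : ∀ {x : ℝ}, x ∈ Ico 0 d → |x| < d₀ := fun hx => by
      rw [abs_of_nonneg hx.1]
      exact hx.2.trans_le (min_le_left _ _)
    exact hne (hdisj s s' ε ε' (habs hε) (habs hε') he)
  · exact fun p hp => (contDiffAt_conjField (hCan p (hUC' hp))).contDiffWithinAt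
  · rw [hUC]
    exact fun p hp => (contDiffAt_conjField (hCan p hp)).continuousAt.continuousWithinAt
  · exact fun p hp => (divg_curl2_conjField (hCan p (hUC' hp))).1
  · exact fun p hp => (divg_curl2_conjField (hCan p (hUC' hp))).2
  · intro v hv
    obtain ⟨s, rfl⟩ := hfr' v hv
    have h1 := htt s
    have h2 := hnor2 _ hv
    rw [hBγ _ hv]
    simp only [dot, hb, Prod.fst_add, Prod.snd_add, Prod.smul_fst, Prod.smul_snd,
      smul_eq_mul] at h1 h2 ⊢
    linear_combination f (γ s) * h1 + h (γ s) * h2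
  · intro v hv
    have h1 := hnn v hv
    have h2 := hnor2 v hv
    rw [hBγ v hv]
    simp only [dot, hb, Prod.fst_add, Prod.snd_add, Prod.smul_fst, Prod.smul_snd,
      smul_eq_mul] at h1 h2 ⊢
    linear_combination f v * h2 + h v * h1
end
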